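/- arXiv:1804.09809 — 3 statements merged into one kernel-verified Lean document; each statement's English description precedes it below -/
import Mathlib

section
/- The principle HT^{=2}_2 is not computably true: there exists a computable coloring c : ℕ → Bool such that no infinite computable subset of ℕ is a solution to c. That is, there is a computable c : ℕ → Bool such that for every set H ⊆ ℕ, if H is computable (as a predicate) and infinite, then there exist x, y, x', y' ∈ H with x ≠ y and x' ≠ y' such that c (x + y) ≠ c (x' + y'). -/
namespace ExactlyTwoSums

open Nat.Partrec (Code)

/-- The pair `(m, N)` represents the closed interval `[m / N, (m + 1) / N]`. -/
def InInterval (p : ℕ × ℕ) (x : ℚ) : Prop :=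
  (p.1 : ℚ) / p.2 ≤ x ∧ x ≤ ((p.1 : ℚ) + 1) / p.2

/-- A subinterval of `p` on which `x ↦ d * x` takes values in some `[2 * j + 1 / 2, 2 * j + 1]`. -/
def refine (d : ℕ) (p : ℕ × ℕ) : ℕ × ℕ :=
  (4 * (d * p.1 / (2 * p.2) + 1) + 1, 2 * d)

/-- The decision procedure with index `e` accepts `a` within `k` steps. -/
def accepts (e k a : ℕ) : Bool :=
  decide (Code.evaln k (Denumerable.ofNat Code e) a = some 1)

/-- The number `w` codes a step bound and three points accepted by the procedure `e` which are
spaced widely enough to refine the interval `p` twice. -/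
def valid (e : ℕ) (p : ℕ × ℕ) (w : ℕ) : Bool :=
  let t := Denumerable.ofNat (ℕ × ℕ × ℕ × ℕ) w
  (accepts e t.1 t.2.1 && accepts e t.1 t.2.2.1 && accepts e t.1 t.2.2.2) &&
    (decide (3 * p.2 ≤ t.2.2.1 - t.2.1) &&
      decide (3 * (2 * (t.2.2.1 - t.2.1)) ≤ t.2.2.2 - t.2.2.1))

/-- The interval obtained from `p` by refining along the three points coded by `w`. -/
def refineBy (p : ℕ × ℕ) (w : ℕ) : ℕ × ℕ :=
  let t := Denumerable.ofNat (ℕ × ℕ × ℕ × ℕ) w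
  refine (t.2.2.2 - t.2.2.1) (refine (t.2.2.1 - t.2.1) p)

/-- Refine `p` along the first witness for the procedure `e` below `s`, if there is one. -/
def step (s e : ℕ) (p : ℕ × ℕ) : ℕ × ℕ :=
  if (List.range s).findIdx (valid e p) < s then
    refineBy p ((List.range s).findIdx (valid e p))
  else p

/-- The stage `s` interval that respects the procedures with index below `e`. -/
def interval (s e : ℕ) : ℕ × ℕ :=
  Nat.rec (0, 1) (fun e p => step s e p) e

/-- The stage `s` slope, as a fraction. -/
def slope (s : ℕ) : ℕ × ℕ := interval s s

/-- The phase at `n`, as a fraction: the sum of all slopes before stage `n`. -/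
def phase (n : ℕ) : ℕ × ℕ :=
  Nat.rec (0, 1) (fun s p => (p.1 * (slope s).2 + (slope s).1 * p.2, p.2 * (slope s).2)) n

/-- The parity of the integer part of the phase. -/
def coloring (n : ℕ) : Bool :=
  decide ((phase n).1 / (phase n).2 % 2 = 1)

section Computability

open Primrec

theorem primrec_refine : Primrec₂ refine := by
  unfold refine
  refine Primrec.pair ?_ ?_
  · exact nat_add.comp (nat_mul.comp (.const 4) (nat_add.comp (nat_div.comp
      (nat_mul.comp fst (fst.comp snd)) (nat_mul.comp (.const 2) (snd.comp snd))) (.const 1)))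
      (.const 1)
  · exact nat_mul.comp (.const 2) fst

theorem primrec_accepts {α : Type*} [Primcodable α] {e k a : α → ℕ}
    (he : Primrec e) (hk : Primrec k) (ha : Primrec a) :
    Primrec fun x => accepts (e x) (k x) (a x) := by
  unfold accepts
  exact Primrec.eq.decide.comp
    (Code.primrec_evaln.comp ((hk.pair ((Primrec.ofNat Code).comp he)).pair ha)) (.const _)

theorem primrec_valid : Primrec fun x : (ℕ × ℕ × ℕ) × ℕ => valid x.1.1 x.1.2 x.2 := by
  have ht : Primrec fun x : (ℕ × ℕ × ℕ) × ℕ => Denumerable.ofNat (ℕ × ℕ × ℕ × ℕ) x.2 :=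
    (Primrec.ofNat _).comp snd
  have he : Primrec fun x : (ℕ × ℕ × ℕ) × ℕ => x.1.1 := fst.comp fst
  have ha := fst.comp (snd.comp ht)
  have hb := fst.comp (snd.comp (snd.comp ht))
  have hc := snd.comp (snd.comp (snd.comp ht))
  have hk := fst.comp ht
  unfold valid
  refine Primrec.and.comp (Primrec.and.comp (Primrec.and.comp (primrec_accepts he hk ha)
    (primrec_accepts he hk hb)) (primrec_accepts he hk hc)) (Primrec.and.comp ?_ ?_)
  · exact nat_le.decide.comp (nat_mul.comp (.const 3) (snd.comp (snd.comp fst)))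
      (nat_sub.comp hb ha)
  · exact nat_le.decide.comp (nat_mul.comp (.const 3) (nat_mul.comp (.const 2)
      (nat_sub.comp hb ha))) (nat_sub.comp hc hb)

theorem primrec_refineBy : Primrec₂ refineBy := by
  have ht : Primrec fun x : (ℕ × ℕ) × ℕ => Denumerable.ofNat (ℕ × ℕ × ℕ × ℕ) x.2 :=
    (Primrec.ofNat _).comp snd
  have ha := fst.comp (snd.comp ht)
  have hb := fst.comp (snd.comp (snd.comp ht))
  have hc := snd.comp (snd.comp (snd.comp ht))
  exact primrec_refine.comp (nat_sub.comp hc hb) (primrec_refine.comp (nat_sub.comp hb ha) fst)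

theorem primrec_step : Primrec fun x : ℕ × ℕ × ℕ × ℕ => step x.1 x.2.1 x.2.2 := by
  have hi : Primrec fun x : ℕ × ℕ × ℕ × ℕ =>
      (List.range x.1).findIdx (valid x.2.1 x.2.2) :=
    list_findIdx (list_range.comp fst) (primrec_valid.comp ((snd.comp fst).pair snd)).to₂
  exact Primrec.ite (nat_lt.comp hi fst) (primrec_refineBy.comp (snd.comp snd) hi) (snd.comp snd)

theorem primrec_slope : Primrec slope := by
  have : Primrec₂ interval :=
    nat_rec' (f := fun x : ℕ × ℕ => x.2) (g := fun _ => ((0, 1) : ℕ × ℕ))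
      (h := fun x y => step x.1 y.1 y.2) snd (.const _)
      (primrec_step.comp ((fst.comp fst).pair snd)).to₂
  exact this.comp .id .id

theorem primrec_coloring : Primrec coloring := by
  have hs : Primrec fun x : ℕ × ℕ × ℕ => slope x.1 := primrec_slope.comp fst
  have hp : Primrec phase := by
    refine nat_rec₁ (f := fun s p =>
      (p.1 * (slope s).2 + (slope s).1 * p.2, p.2 * (slope s).2)) (0, 1) ?_
    exact (nat_add.comp (nat_mul.comp (fst.comp snd) (snd.comp hs))
      (nat_mul.comp (fst.comp hs) (snd.comp snd))).pair
      (nat_mul.comp (snd.comp snd) (snd.comp hs))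
  exact Primrec.eq.decide.comp
    (nat_mod.comp (nat_div.comp (fst.comp hp) (snd.comp hp)) (.const 2)) (.const 1)

end Computability

theorem InInterval.of_refine {d : ℕ} {p : ℕ × ℕ} {x : ℚ} (hp : 0 < p.2) (hd : 3 * p.2 ≤ d)
    (hx : InInterval (refine d p) x) : InInterval p x := by
  obtain ⟨m, N⟩ := p
  simp only [InInterval, refine] at *
  have h1 := Nat.div_mul_le_self (d * m) (2 * N)
  have h2 := Nat.lt_div_mul_add (a := d * m) (b := 2 * N) (by omega)
  generalize d * m / (2 * N) = i at *
  have hN : (0 : ℚ) < N := by exact_mod_cast hp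
  have hd0 : (0 : ℚ) < d := by exact_mod_cast (by omega : 0 < d)
  have h1' : (i : ℚ) * (2 * N) ≤ d * m := by exact_mod_cast h1
  have h2' : (d : ℚ) * m < i * (2 * N) + 2 * N := by exact_mod_cast h2
  have hd' : (3 : ℚ) * N ≤ d := by exact_mod_cast hd
  push_cast at hx
  refine ⟨le_trans ?_ hx.1, hx.2.trans ?_⟩
  · rw [div_le_div_iff₀ hN (by positivity)]
    nlinarith
  · rw [div_le_div_iff₀ (by positivity) hN]
    nlinarith

theorem InInterval.mul_mem {d : ℕ} {p : ℕ × ℕ} (hd : 0 < d) :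
    ∃ j : ℕ, ∀ x, InInterval (refine d p) x → 2 * j + 1 / 2 ≤ d * x ∧ d * x ≤ 2 * j + 1 := by
  refine ⟨d * p.1 / (2 * p.2) + 1, fun x hx => ?_⟩
  simp only [InInterval, refine] at hx
  generalize d * p.1 / (2 * p.2) = i at *
  have hd0 : (0 : ℚ) < d := by exact_mod_cast hd
  push_cast at *
  rw [div_le_iff₀ (by positivity), le_div_iff₀ (by positivity)] at hx
  constructor <;> nlinarith

theorem valid_iff {e : ℕ} {p : ℕ × ℕ} {k a b c : ℕ} :
    valid e p (Encodable.encode (k, a, b, c)) = true ↔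
      (accepts e k a ∧ accepts e k b ∧ accepts e k c) ∧
        3 * p.2 ≤ b - a ∧ 3 * (2 * (b - a)) ≤ c - b := by
  simp [valid, and_assoc]

theorem exists_encode (w : ℕ) : ∃ k a b c : ℕ, w = Encodable.encode (k, a, b, c) :=
  ⟨_, _, _, _, (Denumerable.encode_ofNat (α := ℕ × ℕ × ℕ × ℕ) w).symm⟩

theorem refineBy_encode (p : ℕ × ℕ) (k a b c : ℕ) :
    refineBy p (Encodable.encode (k, a, b, c)) = refine (c - b) (refine (b - a) p) := by
  simp [refineBy]

theorem findIdx_range {q : ℕ → Bool} {s : ℕ} (h : (List.range s).findIdx q < s) :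
    q ((List.range s).findIdx q) = true := by
  have := List.findIdx_getElem (p := q) (xs := List.range s) (w := by simpa using h)
  simpa using this

theorem step_eq_or (s e : ℕ) (p : ℕ × ℕ) :
    step s e p = p ∨ ∃ w, valid e p w = true ∧ step s e p = refineBy p w := by
  unfold step
  split_ifs with h
  · exact .inr ⟨_, findIdx_range h, rfl⟩
  · exact .inl rfl

theorem refineBy_spec {e : ℕ} {p : ℕ × ℕ} {w : ℕ} (hp : 0 < p.2) (hw : valid e p w = true) :
    0 < (refineBy p w).2 ∧ ∀ x, InInterval (refineBy p w) x → InInterval p x := by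
  obtain ⟨k, a, b, c, rfl⟩ := exists_encode w
  rw [valid_iff] at hw
  rw [refineBy_encode]
  refine ⟨by simp only [refine]; omega, fun x hx => ?_⟩
  exact .of_refine hp hw.2.1 (.of_refine (by simp only [refine]; omega) hw.2.2 hx)

theorem step_spec {s e : ℕ} {p : ℕ × ℕ} (hp : 0 < p.2) :
    0 < (step s e p).2 ∧ ∀ x, InInterval (step s e p) x → InInterval p x := by
  obtain h | ⟨w, hw, h⟩ := step_eq_or s e p <;> rw [h]
  · exact ⟨hp, fun _ => id⟩
  · exact refineBy_spec hp hw

theorem interval_pos (s e : ℕ) : 0 < (interval s e).2 := by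
  induction e with
  | zero => exact one_pos
  | succ e ih => exact (step_spec ih).1

theorem InInterval.mono {s e e' : ℕ} (h : e ≤ e') {x : ℚ} (hx : InInterval (interval s e') x) :
    InInterval (interval s e) x := by
  induction e', h using Nat.le_induction with
  | base => exact hx
  | succ e' _ ih => exact ih ((step_spec (interval_pos s e')).2 x hx)

theorem slope_mem {s e : ℕ} (h : e ≤ s) :
    InInterval (interval s e) ((slope s).1 / (slope s).2) := by
  refine InInterval.mono h ⟨le_rfl, ?_⟩
  have : (0 : ℚ) < (interval s s).2 := by exact_mod_cast interval_pos s s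
  simp only [slope]
  gcongr
  linarith

theorem step_of_least {s e : ℕ} {p : ℕ × ℕ} {w : ℕ} (hw : valid e p w = true)
    (hlt : ∀ v < w, valid e p v = false) (hs : w < s) : step s e p = refineBy p w := by
  have : (List.range s).findIdx (valid e p) = w := by
    rw [List.findIdx_eq (by simpa using hs)]
    simpa using ⟨hw, hlt⟩
  rw [step, this, if_pos hs]

/-- A step eventually uses a fixed witness, if there is one. -/
theorem exists_witness {e : ℕ} {p : ℕ × ℕ} (h : ∃ w, valid e p w = true) :
    ∃ w, valid e p w = true ∧ ∀ s, w < s → step s e p = refineBy p w := by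
  classical
  exact ⟨Nat.find h, Nat.find_spec h, fun s hs => step_of_least (Nat.find_spec h)
    (fun v hv => by simpa using Nat.find_min h hv) hs⟩

/-- Each interval reaches a limit. -/
theorem exists_limit (e : ℕ) : ∃ p : ℕ × ℕ, ∃ s₀, ∀ s ≥ s₀, interval s e = p := by
  induction e with
  | zero => exact ⟨(0, 1), 0, fun _ _ => rfl⟩
  | succ e ih =>
    obtain ⟨p, s₀, hp⟩ := ih
    by_cases h : ∃ w, valid e p w = true
    · obtain ⟨w, -, hw⟩ := exists_witness h
      refine ⟨refineBy p w, max s₀ (w + 1), fun s hs => ?_⟩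
      change step s e (interval s e) = _
      rw [hp s (by omega), hw s (by omega)]
    · refine ⟨p, s₀, fun s hs => ?_⟩
      change step s e (interval s e) = _
      rw [hp s hs]
      exact (step_eq_or s e p).resolve_right fun ⟨w, hw, _⟩ => h ⟨w, hw⟩

theorem exists_index {H : Set ℕ} (hH : ComputablePred (· ∈ H)) :
    ∃ e, ∀ a, (a ∈ H → ∃ k₀, ∀ k ≥ k₀, accepts e k a) ∧ ∀ k, accepts e k a → a ∈ H := by
  obtain ⟨_, hc⟩ := hH
  have hn : Nat.Partrec fun a => Part.some (Encodable.encode (decide (a ∈ H))) :=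
    Partrec.nat_iff.1 (Computable.encode.comp hc)
  obtain ⟨f, hf⟩ := Code.exists_code.1 hn
  refine ⟨Encodable.encode f, fun a => ⟨fun ha => ?_, fun k hk => ?_⟩⟩
  · have : 1 ∈ f.eval a := by simp [hf, ha]
    obtain ⟨k₀, hk₀⟩ := Code.evaln_complete.1 this
    exact ⟨k₀, fun k hk => by simpa [accepts] using Code.evaln_mono hk hk₀⟩
  · have : 1 ∈ f.eval a := Code.evaln_sound (k := k) (by simpa [accepts] using hk)
    by_contra ha
    simp [hf, ha] at this

theorem exists_valid {H : Set ℕ} (hinf : H.Infinite) {e : ℕ}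
    (he : ∀ a ∈ H, ∃ k₀, ∀ k ≥ k₀, accepts e k a) (p : ℕ × ℕ) : ∃ w, valid e p w = true := by
  obtain ⟨a, ha⟩ := hinf.nonempty
  obtain ⟨b, hb, hab⟩ := hinf.exists_gt (a + 3 * p.2)
  obtain ⟨c, hc, hbc⟩ := hinf.exists_gt (b + 3 * (2 * (b - a)))
  obtain ⟨k₁, h₁⟩ := he a ha
  obtain ⟨k₂, h₂⟩ := he b hb
  obtain ⟨k₃, h₃⟩ := he c hc
  refine ⟨Encodable.encode (k₁ + k₂ + k₃, a, b, c), valid_iff.2 ⟨⟨h₁ _ ?_, h₂ _ ?_, h₃ _ ?_⟩, ?_⟩⟩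
  all_goals omega

/-- The phase at `n` as a rational number. -/
def phaseRat (n : ℕ) : ℚ := (phase n).1 / (phase n).2

theorem phase_pos (n : ℕ) : 0 < (phase n).2 := by
  induction n with
  | zero => exact one_pos
  | succ n ih => exact Nat.mul_pos ih (interval_pos n n)

theorem phaseRat_succ (n : ℕ) :
    phaseRat (n + 1) = phaseRat n + (slope n).1 / (slope n).2 := by
  have h1 : ((phase n).2 : ℚ) ≠ 0 := by exact_mod_cast (phase_pos n).ne'
  have h2 : ((slope n).2 : ℚ) ≠ 0 := by exact_mod_cast (interval_pos n n).ne'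
  have h : phase (n + 1) = ((phase n).1 * (slope n).2 + (slope n).1 * (phase n).2,
    (phase n).2 * (slope n).2) := rfl
  rw [phaseRat, phaseRat, h]
  push_cast
  field_simp

theorem phaseRat_add_mem {p : ℕ × ℕ} {u : ℕ}
    (h : ∀ i ≥ u, InInterval p ((slope i).1 / (slope i).2)) (d : ℕ) :
    d * ((p.1 : ℚ) / p.2) ≤ phaseRat (u + d) - phaseRat u ∧
      phaseRat (u + d) - phaseRat u ≤ d * (((p.1 : ℚ) + 1) / p.2) := by
  induction d with
  | zero => simp
  | succ d ih =>
    have := h (u + d) (by omega)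
    rw [InInterval] at this
    rw [← add_assoc, phaseRat_succ]
    push_cast
    constructor <;> linarith [ih.1, ih.2, this.1, this.2]

theorem exists_phaseRat_sub {p : ℕ × ℕ} {d u : ℕ} (hd : 0 < d)
    (h : ∀ i ≥ u, InInterval (refine d p) ((slope i).1 / (slope i).2)) :
    ∃ j : ℕ, 2 * j + 1 / 2 ≤ phaseRat (u + d) - phaseRat u ∧
      phaseRat (u + d) - phaseRat u ≤ 2 * j + 1 := by
  obtain ⟨j, hj⟩ := InInterval.mul_mem (p := p) hd
  have hle := (h u le_rfl).1.trans (h u le_rfl).2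
  have hm := phaseRat_add_mem h d
  exact ⟨j, (hj _ ⟨le_rfl, hle⟩).1.trans hm.1, hm.2.trans (hj _ ⟨hle, le_rfl⟩).2⟩

theorem coloring_eq (n : ℕ) : coloring n = decide (⌊phaseRat n⌋₊ % 2 = 1) := by
  rw [coloring, phaseRat, Nat.floor_div_eq_div]

theorem phaseRat_nonneg (n : ℕ) : 0 ≤ phaseRat n := by
  unfold phaseRat
  positivity

theorem floor_add_of_coloring_eq {u v j : ℕ} (hj : 2 * j + 1 / 2 ≤ phaseRat v - phaseRat u)
    (hj' : phaseRat v - phaseRat u ≤ 2 * j + 1) (h : coloring u = coloring v) :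
    ⌊phaseRat v⌋₊ = ⌊phaseRat u⌋₊ + 2 * j := by
  rw [coloring_eq, coloring_eq, decide_eq_decide] at h
  have hu := Nat.floor_le (phaseRat_nonneg u)
  have hu' := Nat.lt_floor_add_one (phaseRat u)
  have hv := Nat.floor_le (phaseRat_nonneg v)
  have hv' := Nat.lt_floor_add_one (phaseRat v)
  generalize ⌊phaseRat u⌋₊ = q at *
  generalize ⌊phaseRat v⌋₊ = r at *
  have h1 : q + 2 * j < r + 1 := by
    have : (q : ℚ) + 2 * j < r + 1 := by linarith
    exact_mod_cast this
  have h2 : r < q + 2 * j + 2 := by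
    have : (r : ℚ) < q + 2 * j + 2 := by linarith
    exact_mod_cast this
  omega

theorem coloring_ne_or {u v w i j : ℕ}
    (hi : 2 * i + 1 / 2 ≤ phaseRat v - phaseRat u) (hi' : phaseRat v - phaseRat u ≤ 2 * i + 1)
    (hj : 2 * j + 1 / 2 ≤ phaseRat w - phaseRat v) (hj' : phaseRat w - phaseRat v ≤ 2 * j + 1) :
    coloring u ≠ coloring v ∨ coloring v ≠ coloring w := by
  by_contra! h
  have h1 := floor_add_of_coloring_eq hi hi' h.1
  have h2 := floor_add_of_coloring_eq hj hj' h.2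
  have hu := Nat.floor_le (phaseRat_nonneg u)
  have hw := Nat.lt_floor_add_one (phaseRat w)
  rw [h2, h1] at hw
  push_cast at hw
  linarith

theorem exists_coloring_ne {H : Set ℕ} (hH : ComputablePred (· ∈ H)) (hinf : H.Infinite) :
    ∃ x ∈ H, ∃ y ∈ H, ∃ x' ∈ H, ∃ y' ∈ H,
      x ≠ y ∧ x' ≠ y' ∧ coloring (x + y) ≠ coloring (x' + y') := by
  obtain ⟨e, he⟩ := exists_index hH
  obtain ⟨p, s₀, hp⟩ := exists_limit e
  obtain ⟨w, hw, hstep⟩ := exists_witness (exists_valid hinf (fun a => (he a).1) p)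
  obtain ⟨k, a, b, c, rfl⟩ := exists_encode w
  rw [refineBy_encode] at hstep
  obtain ⟨⟨ha, hb, hc⟩, hab, hbc⟩ := valid_iff.1 hw
  have hp0 : 0 < p.2 := hp s₀ le_rfl ▸ interval_pos s₀ e
  replace ha := (he a).2 k ha
  replace hb := (he b).2 k hb
  replace hc := (he c).2 k hc
  set w := Encodable.encode (k, a, b, c)
  obtain ⟨x, hx, hxs⟩ := hinf.exists_gt (s₀ + w + e + c + b + a + 1)
  have hc2 : ∀ i ≥ x, InInterval (refine (c - b) (refine (b - a) p))
      ((slope i).1 / (slope i).2) := fun i hi => by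
    have h : interval i (e + 1) = refine (c - b) (refine (b - a) p) := by
      change step i e (interval i e) = _
      rw [hp i (by omega), hstep i (by omega)]
    rw [← h]
    exact slope_mem (by omega)
  have hc1 : ∀ i ≥ x, InInterval (refine (b - a) p) ((slope i).1 / (slope i).2) := fun i hi =>
    .of_refine (by simp only [refine]; omega) hbc (hc2 i hi)
  obtain ⟨i, hi, hi'⟩ := exists_phaseRat_sub (u := x + a) (d := b - a) (by omega)
    fun n hn => hc1 n (by omega)
  obtain ⟨j, hj, hj'⟩ := exists_phaseRat_sub (u := x + b) (d := c - b) (by omega)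
    fun n hn => hc2 n (by omega)
  rw [show x + a + (b - a) = x + b by omega] at hi hi'
  rw [show x + b + (c - b) = x + c by omega] at hj hj'
  obtain h | h := coloring_ne_or hi hi' hj hj'
  · exact ⟨x, hx, a, ha, x, hx, b, hb, by omega, by omega, h⟩
  · exact ⟨x, hx, b, hb, x, hx, c, hc, by omega, by omega, h⟩

end ExactlyTwoSums


/-- **HT^{=2}_2 is not computably true.** There is a computable 2-coloring `c` of ℕ such
that no infinite computable set `H` is a solution of `c` as an instance of `HT^{=2}_2`,
i.e. for every computable infinite `H` there are two pairs of distinct elements of `H`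
whose sums receive different colors. -/
theorem stmt_0 :
    ∃ c : ℕ → Bool, Computable c ∧
      ∀ H : Set ℕ, ComputablePred (· ∈ H) → H.Infinite →
        ∃ x ∈ H, ∃ y ∈ H, ∃ x' ∈ H, ∃ y' ∈ H,
          x ≠ y ∧ x' ≠ y' ∧ c (x + y) ≠ c (x' + y') := by
  exact ⟨ExactlyTwoSums.coloring, ExactlyTwoSums.primrec_coloring.to_comp,
    fun _ hH hinf => ExactlyTwoSums.exists_coloring_ne hH hinf⟩
end

section
/- There is a computable coloring c : ℕ → Bool and a computable function h : ℕ → ℕ such that every solution to c as an instance of HT^{=2}_2 is effectively immune: for every infinite set H ⊆ ℕ such that all sums x + y of distinct x, y ∈ H receive the same color under c, and for every index e, if the computably enumerable set W_e is contained in H, then W_e is finite and its cardinality is less than h e. -/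
section TwoColoring

variable {α ι : Type*} [DecidableEq α]

/-- The two-colorings of `S`, given by the set of points of the first color, for which no hyperedge
`f i` with `i ∈ I` that lies inside `S` is monochromatic. -/
def properColorings (I : Finset ι) (f : ι → Finset α) (S : Finset α) : Finset (Finset α) :=
  {T ∈ S.powerset | ∀ i ∈ I, f i ⊆ S → ¬ f i ⊆ T ∧ ¬ Disjoint (f i) T}

theorem mem_properColorings {I : Finset ι} {f : ι → Finset α} {S T : Finset α} :
    T ∈ properColorings I f S ↔
      T ⊆ S ∧ ∀ i ∈ I, f i ⊆ S → ¬ f i ⊆ T ∧ ¬ Disjoint (f i) T := by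
  simp [properColorings]

theorem inter_mem_properColorings {I : Finset ι} {f : ι → Finset α} {S T R : Finset α}
    (hT : T ∈ properColorings I f S) (hR : R ⊆ S) : T ∩ R ∈ properColorings I f R := by
  rw [mem_properColorings] at hT ⊢
  refine ⟨Finset.inter_subset_right, fun i hi hf => ?_⟩
  obtain ⟨h1, h2⟩ := hT.2 i hi (hf.trans hR)
  refine ⟨fun h => h1 (h.trans Finset.inter_subset_left), fun h => h2 ?_⟩
  rw [Finset.disjoint_left] at h ⊢
  exact fun x hx hxT => h hx (Finset.mem_inter.2 ⟨hxT, hf hx⟩)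

/-- The two-colorings of `insert v S` that restrict to a proper coloring of `S`. -/
def extendedColorings (I : Finset ι) (f : ι → Finset α) (S : Finset α) (v : α) :
    Finset (Finset α) :=
  {T ∈ (insert v S).powerset | T ∩ S ∈ properColorings I f S}

theorem mem_extendedColorings {I : Finset ι} {f : ι → Finset α} {S T : Finset α} {v : α} :
    T ∈ extendedColorings I f S v ↔ T ⊆ insert v S ∧ T ∩ S ∈ properColorings I f S := by
  simp [extendedColorings]

theorem two_mul_card_le_card_extendedColorings (I : Finset ι) (f : ι → Finset α)
    {S : Finset α} {v : α} (hv : v ∉ S) :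
    2 * (properColorings I f S).card ≤ (extendedColorings I f S v).card := by
  have hsub : ∀ T ∈ properColorings I f S, v ∉ T :=
    fun T hT h => hv ((mem_properColorings.1 hT).1 h)
  have hcard : (properColorings I f S ∪ (properColorings I f S).image (insert v)).card =
      2 * (properColorings I f S).card := by
    rw [Finset.card_union_of_disjoint, Finset.card_image_of_injOn, two_mul]
    · intro T hT U hU h
      have h' : (insert v T).erase v = (insert v U).erase v := congrArg (Finset.erase · v) h
      rwa [Finset.erase_insert (hsub T hT), Finset.erase_insert (hsub U hU)] at h'
    · rw [Finset.disjoint_left]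
      intro T hT hT'
      obtain ⟨U, -, rfl⟩ := Finset.mem_image.1 hT'
      exact hsub _ hT (Finset.mem_insert_self v U)
  rw [← hcard]
  refine Finset.card_le_card fun T hT => mem_extendedColorings.2 ?_
  rcases Finset.mem_union.1 hT with hT | hT
  · exact ⟨(mem_properColorings.1 hT).1.trans (Finset.subset_insert v S),
      inter_mem_properColorings hT subset_rfl⟩
  · obtain ⟨U, hU, rfl⟩ := Finset.mem_image.1 hT
    refine ⟨Finset.insert_subset_insert v (mem_properColorings.1 hU).1, ?_⟩
    rw [Finset.insert_inter_of_notMem hv]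
    exact inter_mem_properColorings hU subset_rfl

theorem card_monochromatic_le (I : Finset ι) (f : ι → Finset α) {S : Finset α} {v : α}
    {i : ι} (hvi : v ∈ f i) :
    ({T ∈ extendedColorings I f S v | f i ⊆ T ∨ Disjoint (f i) T} : Finset _).card ≤
      2 * (properColorings I f (S \ f i)).card := by
  have hprod : (properColorings I f (S \ f i) ×ˢ (Finset.univ : Finset Bool)).card =
      2 * (properColorings I f (S \ f i)).card := by
    rw [Finset.card_product, Finset.card_univ, Fintype.card_bool, mul_comm]
  rw [← hprod]
  refine Finset.card_le_card_of_injOn (fun T => (T ∩ (S \ f i), decide (v ∈ T))) ?_ ?_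
  · intro T hT
    have hT' := (mem_extendedColorings.1 (Finset.mem_filter.1 (Finset.mem_coe.1 hT)).1).2
    have := inter_mem_properColorings hT' (Finset.sdiff_subset (s := S) (t := f i))
    rw [Finset.inter_assoc, Finset.inter_eq_right.2 Finset.sdiff_subset] at this
    simpa [em] using this
  · intro T hT U hU h
    obtain ⟨hT, hTm⟩ := Finset.mem_filter.1 (Finset.mem_coe.1 hT)
    obtain ⟨hU, hUm⟩ := Finset.mem_filter.1 (Finset.mem_coe.1 hU)
    have hTS := (mem_extendedColorings.1 hT).1
    have hUS := (mem_extendedColorings.1 hU).1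
    simp only [Prod.mk.injEq, decide_eq_decide] at h
    obtain ⟨h1, h2⟩ := h
    simp only [Finset.disjoint_left] at hTm hUm
    ext x
    have hx := Finset.ext_iff.1 h1 x
    simp only [Finset.mem_inter, Finset.mem_sdiff] at hx
    by_cases hxf : x ∈ f i
    · rcases hTm with hTm | hTm <;> rcases hUm with hUm | hUm
      · exact ⟨fun _ => hUm hxf, fun _ => hTm hxf⟩
      · exact absurd (h2.1 (hTm hvi)) (hUm hvi)
      · exact absurd (h2.2 (hUm hvi)) (hTm hvi)
      · exact ⟨fun h => absurd h (hTm hxf), fun h => absurd h (hUm hxf)⟩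
    · have hxv : x ≠ v := fun h => hxf (h ▸ hvi)
      constructor
      · intro hxT
        exact (hx.1 ⟨hxT, Finset.mem_of_mem_insert_of_ne (hTS hxT) hxv, hxf⟩).1
      · intro hxU
        exact (hx.2 ⟨hxU, Finset.mem_of_mem_insert_of_ne (hUS hxU) hxv, hxf⟩).1

theorem two_mul_card_properColorings_le (I : Finset ι) (f : ι → Finset α) {S : Finset α} {v : α}
    (hv : v ∉ S) :
    2 * (properColorings I f S).card ≤ (properColorings I f (insert v S)).card +
      ∑ i ∈ I with v ∈ f i ∧ f i ⊆ insert v S, 2 * (properColorings I f (S \ f i)).card := by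
  classical
  refine (two_mul_card_le_card_extendedColorings I f hv).trans ?_
  have hsub : extendedColorings I f S v ⊆ properColorings I f (insert v S) ∪
      ({i ∈ I | v ∈ f i ∧ f i ⊆ insert v S} : Finset ι).biUnion fun i =>
        {T ∈ extendedColorings I f S v | f i ⊆ T ∨ Disjoint (f i) T} := by
    intro T hT
    rw [Finset.mem_union, or_iff_not_imp_left]
    intro hTn
    obtain ⟨hTS, hTp⟩ := mem_extendedColorings.1 hT
    rw [mem_properColorings] at hTn
    push Not at hTn
    obtain ⟨i, hi, hfi, hm⟩ := hTn hTS
    have hm' : f i ⊆ T ∨ Disjoint (f i) T := by tauto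
    refine Finset.mem_biUnion.2 ⟨i, Finset.mem_filter.2 ⟨hi, ?_, hfi⟩,
      Finset.mem_filter.2 ⟨hT, hm'⟩⟩
    by_contra hvi
    have hfS : f i ⊆ S := (Finset.subset_insert_iff_of_notMem hvi).1 hfi
    obtain ⟨h1, h2⟩ := (mem_properColorings.1 hTp).2 i hi hfS
    rcases hm' with hm' | hm'
    · exact h1 (Finset.subset_inter hm' hfS)
    · exact h2 (hm'.mono_right Finset.inter_subset_left)
  refine (Finset.card_le_card hsub).trans ((Finset.card_union_le _ _).trans ?_)
  gcongr
  refine Finset.card_biUnion_le.trans (Finset.sum_le_sum fun i hi => ?_)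
  exact card_monochromatic_le I f (Finset.mem_filter.1 hi).2.1

theorem pow_mul_card_properColorings_le (I : Finset ι) (f : ι → Finset α)
    (hf : ∀ v, ∑ i ∈ I with v ∈ f i, 2 * (2 / 3 : ℚ) ^ ((f i).card - 1) ≤ 1 / 2)
    (S : Finset α) : ∀ R ⊆ S, (3 / 2 : ℚ) ^ (S \ R).card * (properColorings I f R).card ≤
      (properColorings I f S).card := by
  induction S using Finset.strongInduction with
  | H S ih =>
    intro R hR
    rcases hR.eq_or_ssubset with rfl | hss
    · simp
    obtain ⟨v, hvS, hvR⟩ := Finset.exists_of_ssubset hss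
    have hlt : S.erase v ⊂ S := Finset.erase_ssubset hvS
    have hle := ih _ hlt R (Finset.subset_erase.2 ⟨hR, hvR⟩)
    have hstep := two_mul_card_properColorings_le I f (Finset.notMem_erase v S)
    rw [Finset.insert_erase hvS] at hstep
    set C : ℚ := ((properColorings I f (S.erase v)).card : ℚ) with hC
    have hstep' : 2 * C ≤ (properColorings I f S).card +
        ∑ i ∈ I with v ∈ f i ∧ f i ⊆ S,
          2 * ((properColorings I f (S.erase v \ f i)).card : ℚ) := by
      rw [hC]
      exact_mod_cast hstep
    have hsum : ∑ i ∈ I with v ∈ f i ∧ f i ⊆ S,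
        2 * ((properColorings I f (S.erase v \ f i)).card : ℚ) ≤ 1 / 2 * C := by
      calc _ ≤ ∑ i ∈ I with v ∈ f i ∧ f i ⊆ S, 2 * (2 / 3 : ℚ) ^ ((f i).card - 1) * C := by
            refine Finset.sum_le_sum fun i hi => ?_
            obtain ⟨-, hvi, hfS⟩ := Finset.mem_filter.1 hi
            have h := ih _ hlt (S.erase v \ f i) Finset.sdiff_subset
            have hc : (S.erase v \ (S.erase v \ f i)).card = (f i).card - 1 := by
              rw [← Finset.card_erase_of_mem hvi]
              congr 1
              ext x
              have := @hfS x
              simp only [Finset.mem_sdiff, Finset.mem_erase]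
              tauto
            rw [hc] at h
            have hinv : (2 / 3 : ℚ) ^ ((f i).card - 1) * (3 / 2) ^ ((f i).card - 1) = 1 := by
              rw [← mul_pow]; norm_num
            have h' := mul_le_mul_of_nonneg_left h
              (by positivity : (0 : ℚ) ≤ (2 / 3 : ℚ) ^ ((f i).card - 1))
            rw [← mul_assoc, hinv, one_mul] at h'
            rw [mul_assoc]
            gcongr
        _ ≤ ∑ i ∈ I with v ∈ f i, 2 * (2 / 3 : ℚ) ^ ((f i).card - 1) * C := by
            refine Finset.sum_le_sum_of_subset_of_nonneg ?_ fun _ _ _ => by positivity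
            intro i hi
            simp only [Finset.mem_filter] at hi ⊢
            exact ⟨hi.1, hi.2.1⟩
        _ ≤ 1 / 2 * C := by
            rw [← Finset.sum_mul]
            gcongr
            exact hf v
    have hcard : (S \ R).card = (S.erase v \ R).card + 1 := by
      have : S.erase v \ R = (S \ R).erase v := by
        ext x
        simp only [Finset.mem_sdiff, Finset.mem_erase]
        tauto
      rw [this, Finset.card_erase_add_one (Finset.mem_sdiff.2 ⟨hvS, hvR⟩)]
    rw [hcard, pow_succ]
    linarith

/-- A finite hypergraph with few small edges through each vertex has property B. -/
theorem exists_forall_not_monochromatic (I : Finset ι) (f : ι → Finset α)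
    (hne : ∀ i ∈ I, (f i).Nonempty)
    (hf : ∀ v, ∑ i ∈ I with v ∈ f i, 2 * (2 / 3 : ℚ) ^ ((f i).card - 1) ≤ 1 / 2) :
    ∃ T : Finset α, ∀ i ∈ I, (∃ x ∈ f i, x ∈ T) ∧ ∃ x ∈ f i, x ∉ T := by
  have h := pow_mul_card_properColorings_le I f hf (I.biUnion f) ∅ (Finset.empty_subset _)
  have hempty : ∅ ∈ properColorings I f ∅ := by
    refine mem_properColorings.2 ⟨subset_rfl, fun i hi hfi => ?_⟩
    exact absurd (Finset.subset_empty.1 hfi) (hne i hi).ne_empty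
  have hpos : 0 < (properColorings I f ∅).card := Finset.card_pos.2 ⟨∅, hempty⟩
  have hpos' : (0 : ℚ) < (properColorings I f (I.biUnion f)).card :=
    lt_of_lt_of_le (by positivity) h
  obtain ⟨T, hT⟩ := Finset.card_pos.1 (Nat.cast_pos.1 hpos')
  refine ⟨T, fun i hi => ?_⟩
  obtain ⟨h1, h2⟩ := (mem_properColorings.1 hT).2 i hi (Finset.subset_biUnion_of_mem f hi)
  exact ⟨Finset.not_disjoint_iff.1 h2, Finset.not_subset.1 h1⟩

end TwoColoring

section Translates

theorem sum_translates_le {κ : Type*} (K : Finset κ) (F : κ → Finset ℕ) (B v : ℕ) (r : κ → ℚ)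
    (hr : ∀ a, 0 ≤ r a) :
    ∑ i ∈ K ×ˢ Finset.range B with v ∈ (F i.1).map (addRightEmbedding i.2), r i.1 ≤
      ∑ a ∈ K, (F a).card * r a := by
  rw [Finset.sum_filter, Finset.sum_product]
  refine Finset.sum_le_sum fun a _ => ?_
  dsimp only
  rw [← Finset.sum_filter, Finset.sum_const, nsmul_eq_mul]
  refine mul_le_mul_of_nonneg_right (Nat.cast_le.2 ?_) (hr a)
  refine Finset.card_le_card_of_injOn (fun s => v - s) ?_ ?_
  · intro s hs
    obtain ⟨x, hx, rfl⟩ := Finset.mem_map.1 (Finset.mem_filter.1 (Finset.mem_coe.1 hs)).2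
    simpa using hx
  · intro s hs t ht h
    obtain ⟨x, -, hx⟩ := Finset.mem_map.1 (Finset.mem_filter.1 (Finset.mem_coe.1 hs)).2
    obtain ⟨y, -, hy⟩ := Finset.mem_map.1 (Finset.mem_filter.1 (Finset.mem_coe.1 ht)).2
    simp only [addRightEmbedding_apply] at hx hy h
    omega

theorem exists_forall_translate_not_monochromatic {κ : Type*} (K : Finset κ) (F : κ → Finset ℕ)
    (B : ℕ) (hne : ∀ a ∈ K, (F a).Nonempty)
    (hF : ∑ a ∈ K, ((F a).card : ℚ) * (2 * (2 / 3 : ℚ) ^ ((F a).card - 1)) ≤ 1 / 2) :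
    ∃ T : Finset ℕ, ∀ a ∈ K, ∀ s < B, (∃ x ∈ F a, x + s ∈ T) ∧ ∃ x ∈ F a, x + s ∉ T := by
  obtain ⟨T, hT⟩ := exists_forall_not_monochromatic (K ×ˢ Finset.range B)
    (fun i => (F i.1).map (addRightEmbedding i.2))
    (fun i hi => (hne i.1 (Finset.mem_product.1 hi).1).map) (fun v => by
      simp only [Finset.card_map]
      exact (sum_translates_le K F B v (fun a => 2 * (2 / 3 : ℚ) ^ ((F a).card - 1))
        fun a => by positivity).trans hF)
  refine ⟨T, fun a ha s hs => ?_⟩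
  simpa using hT (a, s) (Finset.mem_product.2 ⟨ha, Finset.mem_range.2 hs⟩)

end Translates

/-- The number of elements in each of the two chunks taken from the `e`-th c.e. set. -/
def chunkSize (e : ℕ) : ℕ := 4 * e + 16

theorem chunkSize_mul_pow_le (e : ℕ) :
    (chunkSize e : ℚ) * (2 / 3) ^ (chunkSize e - 1) ≤ (1 / 2) ^ (e + 4) := by
  have hsub : ∀ e, chunkSize e - 1 = 4 * e + 15 := fun e => by simp [chunkSize]
  rw [hsub]
  induction e with
  | zero => norm_num [chunkSize]
  | succ e ih =>
    have hsize : (chunkSize (e + 1) : ℚ) ≤ 2 * chunkSize e := by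
      norm_num [chunkSize]; linarith [(Nat.cast_nonneg e : (0 : ℚ) ≤ e)]
    calc (chunkSize (e + 1) : ℚ) * (2 / 3) ^ (4 * (e + 1) + 15)
        ≤ 2 * chunkSize e * (2 / 3) ^ (4 * (e + 1) + 15) := by gcongr
      _ = (32 / 81) * (chunkSize e * (2 / 3) ^ (4 * e + 15)) := by ring
      _ ≤ (1 / 2) * (1 / 2) ^ (e + 4) := mul_le_mul (by norm_num) ih (by positivity) (by norm_num)
      _ = (1 / 2) ^ (e + 1 + 4) := by ring

theorem sum_chunkSize_le (k : ℕ) :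
    ∑ e ∈ Finset.range k, (4 : ℚ) * (chunkSize e * (2 / 3) ^ (chunkSize e - 1)) ≤ 1 / 2 := by
  suffices h : ∀ k, ∑ e ∈ Finset.range k, (4 : ℚ) * (1 / 2) ^ (e + 4) =
      1 / 2 - 1 / 2 * (1 / 2) ^ k by
    calc _ ≤ ∑ e ∈ Finset.range k, (4 : ℚ) * (1 / 2) ^ (e + 4) :=
          Finset.sum_le_sum fun e _ => by gcongr; exact chunkSize_mul_pow_le e
      _ ≤ 1 / 2 := by rw [h]; linarith [show (0 : ℚ) ≤ (1 / 2) ^ k by positivity]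
  intro k
  induction k with
  | zero => simp
  | succ k ih => rw [Finset.sum_range_succ, ih]; ring

open Nat.Partrec (Code)
open Nat.Partrec.Code (evaln)

/-- The elements of the `e`-th c.e. set enumerated within `k` steps, in increasing order. -/
def enumerated (k e : ℕ) : List ℕ :=
  (List.range k).filter fun n => (evaln k (Denumerable.ofNat Code e) n).isSome

/-- The `j`-th block of `chunkSize e` consecutive elements of `enumerated k e`. -/
def chunk (k e j : ℕ) : List ℕ :=
  ((enumerated k e).drop (j * chunkSize e)).take (chunkSize e)

/-- The word `w`, read as a coloring of an initial segment of `ℕ`, is not constant on the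
translates by less than `(k + 1) ^ 2` of the full chunks known at stage `k`. -/
def IsGoodWord (k : ℕ) (w : List Bool) : Prop :=
  ∀ e < k, ∀ j < 2, (chunk k e j).length = chunkSize e → ∀ s < (k + 1) * (k + 1),
    (∃ x ∈ chunk k e j, w[x + s]? = some true) ∧ ∃ x ∈ chunk k e j, w[x + s]? = some false

theorem chunk_nodup (k e j : ℕ) : (chunk k e j).Nodup :=
  ((List.nodup_range.filter _).sublist (List.drop_sublist _ _)).sublist (List.take_sublist _ _)

theorem lt_of_mem_chunk {k e j x : ℕ} (hx : x ∈ chunk k e j) : x < k := by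
  have := List.mem_of_mem_drop (List.mem_of_mem_take hx)
  simpa using List.mem_range.1 (List.mem_filter.1 this).1

theorem exists_isGoodWord (k : ℕ) : ∃ w, IsGoodWord k w := by
  let K : Finset (ℕ × ℕ) := {a ∈ Finset.range k ×ˢ Finset.range 2 |
    (chunk k a.1 a.2).length = chunkSize a.1}
  have hcard : ∀ a ∈ K, (chunk k a.1 a.2).toFinset.card = chunkSize a.1 := fun a ha => by
    rw [List.toFinset_card_of_nodup (chunk_nodup _ _ _), (Finset.mem_filter.1 ha).2]
  obtain ⟨T, hT⟩ := exists_forall_translate_not_monochromatic K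
    (fun a => (chunk k a.1 a.2).toFinset) ((k + 1) * (k + 1))
    (fun a ha => Finset.card_pos.1 (by rw [hcard a ha]; simp [chunkSize])) (by
      calc _ = ∑ a ∈ K, (chunkSize a.1 : ℚ) * (2 * (2 / 3 : ℚ) ^ (chunkSize a.1 - 1)) :=
            Finset.sum_congr rfl fun a ha => by rw [hcard a ha]
        _ ≤ ∑ a ∈ Finset.range k ×ˢ Finset.range 2,
              (chunkSize a.1 : ℚ) * (2 * (2 / 3 : ℚ) ^ (chunkSize a.1 - 1)) :=
            Finset.sum_le_sum_of_subset_of_nonneg (Finset.filter_subset _ _)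
              fun _ _ _ => by positivity
        _ = ∑ e ∈ Finset.range k, (4 : ℚ) * (chunkSize e * (2 / 3) ^ (chunkSize e - 1)) := by
            rw [Finset.sum_product]
            refine Finset.sum_congr rfl fun e _ => ?_
            dsimp only
            rw [Finset.sum_const, Finset.card_range, nsmul_eq_mul]
            push_cast
            ring
        _ ≤ 1 / 2 := sum_chunkSize_le k)
  refine ⟨(List.range (k + (k + 1) * (k + 1))).map fun n => decide (n ∈ T), ?_⟩
  intro e he j hj hlen s hs
  have hget : ∀ x ∈ chunk k e j,
      ((List.range (k + (k + 1) * (k + 1))).map fun n => decide (n ∈ T))[x + s]? =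
        some (decide (x + s ∈ T)) := fun x hx => by
    have := lt_of_mem_chunk hx
    rw [List.getElem?_map, List.getElem?_range (by omega), Option.map_some]
  obtain ⟨⟨x, hx, hxT⟩, ⟨y, hy, hyT⟩⟩ := hT (e, j) (Finset.mem_filter.2
    ⟨Finset.mem_product.2 ⟨Finset.mem_range.2 he, Finset.mem_range.2 hj⟩, hlen⟩) s hs
  rw [List.mem_toFinset] at hx hy
  exact ⟨⟨x, hx, by rw [hget x hx]; simpa using hxT⟩, ⟨y, hy, by rw [hget y hy]; simpa using hyT⟩⟩

section Computability

open Primrec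

theorem primrec_chunkSize : Primrec chunkSize :=
  nat_add.comp (nat_mul.comp (const 4) .id) (const 16)

theorem primrec_enumerated : Primrec₂ enumerated := by
  have hR : PrimrecRel fun (n : ℕ) (p : ℕ × ℕ) =>
      (evaln p.1 (Denumerable.ofNat Code p.2) n).isSome = true :=
    Primrec.eq.comp (option_isSome.comp (Nat.Partrec.Code.primrec_evaln.comp
      (((fst.comp snd).pair ((Primrec.ofNat Code).comp (snd.comp snd))).pair fst))) (const true)
  exact ((hR.listFilter).comp (list_range.comp fst) .id).of_eq fun p => by
    simp [enumerated]

theorem primrec_chunk : Primrec fun p : ℕ × ℕ × ℕ => chunk p.1 p.2.1 p.2.2 :=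
  list_take.comp (primrec_chunkSize.comp (fst.comp snd))
    (list_drop.comp (nat_mul.comp (snd.comp snd) (primrec_chunkSize.comp (fst.comp snd)))
      (primrec_enumerated.comp fst (fst.comp snd)))

theorem PrimrecRel.forall_lt_param {β : Type*} [Primcodable β] {R : ℕ → β → Prop}
    (hR : PrimrecRel R) : PrimrecRel fun n b => ∀ x < n, R x b :=
  (hR.forall_mem_list.comp (list_range.comp fst) snd).of_eq fun p => by
    simp only [List.mem_range]

theorem primrecPred_isGoodWord : PrimrecPred fun p : ℕ × List Bool => IsGoodWord p.1 p.2 := by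
  have hget : ∀ b : Bool, PrimrecRel fun (x : ℕ) (q : ℕ × List Bool) =>
      q.2[x + q.1]? = some b := fun b =>
    Primrec.eq.comp (list_getElem?.comp (snd.comp snd) (nat_add.comp fst (fst.comp snd)))
      (const (some b))
  have hex : PrimrecRel fun (s : ℕ) (q : (ℕ × ℕ × ℕ) × List Bool) =>
      (∃ x ∈ chunk q.1.1 q.1.2.1 q.1.2.2, q.2[x + s]? = some true) ∧
        ∃ x ∈ chunk q.1.1 q.1.2.1 q.1.2.2, q.2[x + s]? = some false :=
    PrimrecPred.and
      ((hget true).exists_mem_list.comp (primrec_chunk.comp (fst.comp snd))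
        (fst.pair (snd.comp snd)))
      ((hget false).exists_mem_list.comp (primrec_chunk.comp (fst.comp snd))
        (fst.pair (snd.comp snd)))
  have hs : PrimrecPred fun q : (ℕ × ℕ × ℕ) × List Bool =>
      (chunk q.1.1 q.1.2.1 q.1.2.2).length = chunkSize q.1.2.1 →
        ∀ s < (q.1.1 + 1) * (q.1.1 + 1),
      (∃ x ∈ chunk q.1.1 q.1.2.1 q.1.2.2, q.2[x + s]? = some true) ∧
        ∃ x ∈ chunk q.1.1 q.1.2.1 q.1.2.2, q.2[x + s]? = some false := by
    have h1 : Primrec fun q : (ℕ × ℕ × ℕ) × List Bool => q.1.1 + 1 :=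
      Primrec.succ.comp (fst.comp fst)
    refine ((PrimrecPred.not (Primrec.eq.comp (list_length.comp (primrec_chunk.comp fst))
      (primrec_chunkSize.comp (fst.comp (snd.comp fst))))).or
        (hex.forall_lt_param.comp (nat_mul.comp h1 h1) .id)).of_eq fun q => ?_
    exact imp_iff_not_or.symm
  have hj : PrimrecRel fun (j : ℕ) (q : (ℕ × ℕ) × List Bool) =>
      (chunk q.1.1 q.1.2 j).length = chunkSize q.1.2 →
        ∀ s < (q.1.1 + 1) * (q.1.1 + 1),
      (∃ x ∈ chunk q.1.1 q.1.2 j, q.2[x + s]? = some true) ∧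
        ∃ x ∈ chunk q.1.1 q.1.2 j, q.2[x + s]? = some false :=
    hs.comp (((fst.comp (fst.comp snd)).pair ((snd.comp (fst.comp snd)).pair fst)).pair
      (snd.comp snd))
  have he : PrimrecRel fun (e : ℕ) (q : ℕ × List Bool) => ∀ j < 2,
      (chunk q.1 e j).length = chunkSize e →
        ∀ s < (q.1 + 1) * (q.1 + 1),
      (∃ x ∈ chunk q.1 e j, q.2[x + s]? = some true) ∧
        ∃ x ∈ chunk q.1 e j, q.2[x + s]? = some false :=
    hj.forall_lt_param.comp (const 2) (((fst.comp snd).pair fst).pair (snd.comp snd))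
  exact he.forall_lt_param.comp fst .id

theorem exists_computable_isGoodWord :
    ∃ W : ℕ → List Bool, Computable W ∧ ∀ k, IsGoodWord k (W k) := by
  classical
  let D : ℕ → List Bool := fun m => (Encodable.decode m : Option (List Bool)).getD []
  have hD : Primrec D := option_getD.comp Primrec.decode (const [])
  have hp : Primrec₂ fun (k m : ℕ) => decide (IsGoodWord k (D m)) :=
    (primrecPred_isGoodWord.comp (fst.pair (hD.comp snd))).decide
  have hex : ∀ k, ∃ m, IsGoodWord k (D m) := fun k => by
    obtain ⟨w, hw⟩ := exists_isGoodWord k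
    exact ⟨Encodable.encode w, by simpa [D] using hw⟩
  have hfind : Computable fun k => Nat.find (hex k) := by
    refine (Partrec.rfind hp.to_comp.partrec₂).of_eq fun k => Part.eq_some_iff.2 ?_
    refine Nat.mem_rfind.2 ⟨?_, fun {m} hm => ?_⟩
    · simpa using Nat.find_spec (hex k)
    · simpa using Nat.find_min (hex k) hm
  exact ⟨fun k => D (Nat.find (hex k)), hD.to_comp.comp hfind, fun k => Nat.find_spec (hex k)⟩

end Computability

/-- The `e`-th c.e. set. -/
def ceSet (e : ℕ) : Set ℕ := {n | ((Denumerable.ofNat Code e).eval n).Dom}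

theorem mem_ceSet_of_isSome {k e n : ℕ}
    (h : (evaln k (Denumerable.ofNat Code e) n).isSome) : n ∈ ceSet e := by
  obtain ⟨x, hx⟩ := Option.isSome_iff_exists.1 h
  exact Part.dom_iff_mem.2 ⟨x, Nat.Partrec.Code.evaln_sound hx⟩

theorem exists_forall_isSome_of_mem_ceSet (e M : ℕ) :
    ∃ k₀, ∀ k ≥ k₀, ∀ n < M, n ∈ ceSet e → (evaln k (Denumerable.ofNat Code e) n).isSome := by
  have h : ∀ n, ∃ k₀, ∀ k ≥ k₀, n ∈ ceSet e →
      (evaln k (Denumerable.ofNat Code e) n).isSome := fun n => by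
    by_cases hn : n ∈ ceSet e
    · obtain ⟨x, hx⟩ := Part.dom_iff_mem.1 hn
      obtain ⟨k₀, hk₀⟩ := Nat.Partrec.Code.evaln_complete.1 hx
      exact ⟨k₀, fun k hk _ => Option.isSome_iff_exists.2
        ⟨x, Nat.Partrec.Code.evaln_mono hk hk₀⟩⟩
    · exact ⟨0, fun _ _ h => absurd h hn⟩
  choose K hK using h
  exact ⟨(Finset.range M).sup K, fun k hk n hn =>
    hK n k ((Finset.le_sup (Finset.mem_range.2 hn)).trans hk)⟩

open Classical in
theorem exists_enumerated_eq_append (e M : ℕ) : ∃ k₀, ∀ k ≥ k₀, ∃ R,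
    enumerated k e = (List.range M).filter (fun n => decide (n ∈ ceSet e)) ++ R := by
  obtain ⟨k₀, hk₀⟩ := exists_forall_isSome_of_mem_ceSet e M
  refine ⟨max M k₀, fun k hk => ?_⟩
  obtain ⟨d, rfl⟩ := Nat.exists_eq_add_of_le ((le_max_left _ _).trans hk)
  refine ⟨((List.range d).map (M + ·)).filter fun n =>
    (evaln (M + d) (Denumerable.ofNat Code e) n).isSome, ?_⟩
  rw [enumerated, List.range_add, List.filter_append]
  congr 1
  refine List.filter_congr fun n hn => ?_
  rw [Bool.eq_iff_iff, decide_eq_true_iff]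
  exact ⟨mem_ceSet_of_isSome,
    hk₀ _ ((le_max_right _ _).trans hk) n (List.mem_range.1 hn)⟩

open Classical in
theorem exists_le_length_filter_range {A : Set ℕ} {N : ℕ} (hA : A.Finite → N ≤ A.ncard) :
    ∃ M, N ≤ ((List.range M).filter fun n => decide (n ∈ A)).length := by
  obtain ⟨t, htA, htc⟩ : ∃ t : Finset ℕ, ↑t ⊆ A ∧ t.card = N := by
    by_cases hfin : A.Finite
    · obtain ⟨t, ht, htc⟩ := Finset.exists_subset_card_eq
        ((hA hfin).trans_eq (Set.ncard_eq_toFinset_card A hfin))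
      exact ⟨t, fun x hx => hfin.mem_toFinset.1 (ht hx), htc⟩
    · exact Set.Infinite.exists_subset_card_eq hfin N
  refine ⟨t.sup id + 1, ?_⟩
  rw [← htc]
  refine (Finset.card_le_card fun x hx => ?_).trans (List.toFinset_card_le _)
  rw [List.mem_toFinset, List.mem_filter, List.mem_range, decide_eq_true_iff]
  exact ⟨Nat.lt_succ_of_le (Finset.le_sup (f := id) hx), htA hx⟩

/-- Two blocks of elements of a large c.e. set, the first below the second, that are the two chunks
at every late enough stage. -/
theorem exists_stable_chunks (e : ℕ)
    (hcard : (ceSet e).Finite → 2 * chunkSize e ≤ (ceSet e).ncard) :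
    ∃ L₀ L₁ : List ℕ, L₀.length = chunkSize e ∧ L₁.length = chunkSize e ∧
      (∀ x ∈ L₀, ∀ y ∈ L₁, x < y) ∧ (∀ x ∈ L₀, x ∈ ceSet e) ∧ (∀ x ∈ L₁, x ∈ ceSet e) ∧
      ∃ k₀, ∀ k ≥ k₀, chunk k e 0 = L₀ ∧ chunk k e 1 = L₁ := by
  classical
  obtain ⟨M, hM⟩ := exists_le_length_filter_range hcard
  obtain ⟨k₀, hk₀⟩ := exists_enumerated_eq_append e M
  set L := (List.range M).filter fun n => decide (n ∈ ceSet e) with hL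
  have hmem : ∀ x ∈ L, x ∈ ceSet e := fun x hx => by simpa using (List.mem_filter.1 hx).2
  have hsorted : L.Pairwise (· < ·) := List.pairwise_lt_range.filter _
  rw [← List.take_append_drop (chunkSize e) L, List.pairwise_append] at hsorted
  refine ⟨L.take (chunkSize e), (L.drop (chunkSize e)).take (chunkSize e), ?_, ?_,
    fun x hx y hy => hsorted.2.2 x hx y (List.mem_of_mem_take hy),
    fun x hx => hmem x (List.mem_of_mem_take hx),
    fun x hx => hmem x (List.mem_of_mem_drop (List.mem_of_mem_take hx)), k₀, fun k hk => ?_⟩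
  · rw [List.length_take]; omega
  · rw [List.length_take, List.length_drop]; omega
  · obtain ⟨R, hR⟩ := hk₀ k hk
    constructor
    · rw [chunk, hR, zero_mul, List.drop_zero, List.take_append_of_le_length (by omega)]
    · rw [chunk, hR, one_mul, List.drop_append_of_le_length (by omega),
        List.take_append_of_le_length (by rw [List.length_drop]; omega)]

/-- The coloring that follows the word `W k` on the interval `[k ^ 2, (k + 1) ^ 2)`. -/
def blockColoring (W : ℕ → List Bool) (n : ℕ) : Bool := (W n.sqrt).getD n false

theorem computable_blockColoring {W : ℕ → List Bool} (hW : Computable W) :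
    Computable (blockColoring W) :=
  (Primrec.list_getD false).to_comp.comp (hW.comp Primrec.nat_sqrt.to_comp) .id

theorem blockColoring_not_constant_of_chunk {W : ℕ → List Bool} (hW : ∀ k, IsGoodWord k (W k))
    {k e j s : ℕ} (he : e < k) (hj : j < 2) (hlen : (chunk k e j).length = chunkSize e)
    (hs : s < (k + 1) * (k + 1)) (hsqrt : ∀ x ∈ chunk k e j, (x + s).sqrt = k) (b : Bool) :
    ∃ x ∈ chunk k e j, blockColoring W (x + s) = b := by
  obtain ⟨⟨x, hx, hxc⟩, ⟨y, hy, hyc⟩⟩ := hW k e he j hj hlen s hs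
  cases b
  · exact ⟨y, hy, by simp [blockColoring, hsqrt y hy, hyc]⟩
  · exact ⟨x, hx, by simp [blockColoring, hsqrt x hx, hxc]⟩

theorem blockColoring_eventually_not_constant {W : ℕ → List Bool}
    (hW : ∀ k, IsGoodWord k (W k)) (e : ℕ)
    (hcard : (ceSet e).Finite → 2 * chunkSize e ≤ (ceSet e).ncard) :
    ∃ s₀, ∀ s ≥ s₀, ∀ b, ∃ x ∈ ceSet e, x < s ∧ blockColoring W (x + s) = b := by
  obtain ⟨L₀, L₁, hlen₀, hlen₁, hlt, hmem₀, hmem₁, k₀, hk₀⟩ := exists_stable_chunks e hcard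
  refine ⟨(k₀ + e + 1) * (k₀ + e + 1), fun s hs b => ?_⟩
  obtain ⟨k, hk⟩ : ∃ k, k = s.sqrt := ⟨_, rfl⟩
  have hkle : k₀ + e + 1 ≤ k := hk ▸ Nat.le_sqrt.2 hs
  have hks : k * k ≤ s := hk ▸ Nat.sqrt_le s
  have hsk : s < (k + 1) * (k + 1) := hk ▸ Nat.lt_succ_sqrt s
  have hkk : k ≤ k * k := Nat.le_mul_self k
  obtain ⟨h₀, h₁⟩ := hk₀ k (by omega)
  obtain ⟨-, h₁'⟩ := hk₀ (k + 1) (by omega)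
  have hL₀ : ∀ x ∈ L₀, x < k := fun x hx => lt_of_mem_chunk (h₀ ▸ hx)
  have hL₁ : ∀ x ∈ L₁, x < k := fun x hx => lt_of_mem_chunk (h₁ ▸ hx)
  by_cases hcut : ∀ x ∈ L₀, x + s < (k + 1) * (k + 1)
  · obtain ⟨x, hx, hxb⟩ := blockColoring_not_constant_of_chunk hW (k := k) (e := e) (j := 0)
      (by omega) (by omega) (by rw [h₀, hlen₀]) hsk (fun x hx => by
        rw [h₀] at hx
        exact (Nat.eq_sqrt.2 ⟨by omega, hcut x hx⟩).symm) b
    rw [h₀] at hx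
    have := hL₀ x hx
    exact ⟨x, hmem₀ x hx, by omega, hxb⟩
  · push Not at hcut
    obtain ⟨z, hz, hzs⟩ := hcut
    have hnext : (k + 1 + 1) * (k + 1 + 1) = (k + 1) * (k + 1) + 2 * k + 3 := by ring
    obtain ⟨x, hx, hxb⟩ := blockColoring_not_constant_of_chunk hW (k := k + 1) (e := e) (j := 1)
      (by omega) (by omega) (by rw [h₁', hlen₁]) (s := s) (by omega) (fun x hx => by
        rw [h₁'] at hx
        have := hlt z hz x hx
        have := hL₁ x hx
        exact (Nat.eq_sqrt.2 ⟨by omega, by omega⟩).symm) b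
    rw [h₁'] at hx
    have := hL₁ x hx
    exact ⟨x, hmem₁ x hx, by omega, hxb⟩

/-- There is a computable instance `c` of `HT^{=2}_2` together with a computable bound
`h` witnessing that every solution of `c` is effectively immune: if `H` is an infinite
set on which all sums of two distinct elements get the same color under `c`, then any
c.e. set `W_e` contained in `H` is finite of cardinality less than `h e`. -/
theorem stmt_1 :
    ∃ c : ℕ → Bool, ∃ h : ℕ → ℕ, Computable c ∧ Computable h ∧
      ∀ H : Set ℕ, H.Infinite →
        (∃ i : Bool, ∀ x ∈ H, ∀ y ∈ H, x ≠ y → c (x + y) = i) →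
        ∀ e : Nat.Partrec.Code,
          {n : ℕ | (e.eval n).Dom} ⊆ H →
            {n : ℕ | (e.eval n).Dom}.Finite ∧
              {n : ℕ | (e.eval n).Dom}.ncard < h (Encodable.encode e) := by
  obtain ⟨W, hWc, hW⟩ := exists_computable_isGoodWord
  refine ⟨blockColoring W, fun e => 2 * chunkSize e, computable_blockColoring hWc,
    (Primrec.nat_mul.comp (Primrec.const 2) primrec_chunkSize).to_comp, ?_⟩
  rintro H hH ⟨i, hi⟩ e heH
  have he : ceSet (Encodable.encode e) = {n : ℕ | (e.eval n).Dom} := by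
    simp [ceSet]
  rw [← he] at heH ⊢
  by_contra hcon
  obtain ⟨s₀, hs₀⟩ := blockColoring_eventually_not_constant hW (Encodable.encode e)
    fun hfin => not_lt.1 fun hlt => hcon ⟨hfin, hlt⟩
  obtain ⟨s, hsH, hs⟩ := hH.exists_gt s₀
  obtain ⟨x, hx, hxs, hxc⟩ := hs₀ s hs.le (!i)
  rw [hi x (heH hx) s hsH hxs.ne] at hxc
  cases i <;> simp at hxc
end

section
/- Let f : ℕ → ℕ → ℕ be a symmetric addition-like function. Then there is a computable coloring c : ℕ → Bool and a computable function h : ℕ → ℕ such that every solution to c as an instance of RT^f_2 is effectively immune: for every infinite set H ⊆ ℕ such that c (f x y) takes a constant value over all x, y ∈ H with x ≠ y, and for every index e, if the computably enumerable set W_e is contained in H, then W_e is finite and its cardinality is less than h e. -/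
/-- `f` is addition-like: it is computable; there is a computable `g` such that
`f x y > n` whenever `y > g x n`; and there is a bound `b` such that for all `x ≠ y`
there are at most `b` many `z ≠ x` with `f x z = f x y`. -/
def AdditionLike (f : ℕ → ℕ → ℕ) : Prop :=
  Computable₂ f ∧
  (∃ g : ℕ → ℕ → ℕ, Computable₂ g ∧ ∀ x n y, y > g x n → f x y > n) ∧
  (∃ b : ℕ, ∀ x y, x ≠ y →
    ∀ S : Finset ℕ, (∀ z ∈ S, z ≠ x ∧ f x z = f x y) → S.card ≤ b)

open Finset

theorem Computable.sum_range {α : Type*} [Primcodable α] {n : α → ℕ} {F : α → ℕ → ℕ}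
    (hn : Computable n) (hF : Computable₂ F) :
    Computable fun a => ∑ i ∈ range (n a), F a i := by
  refine (Computable.nat_rec (f := n) (g := fun _ => 0)
    (h := fun a (q : ℕ × ℕ) => q.2 + F a q.1) hn (Computable.const 0) ?_).of_eq ?_
  · exact (Primrec.nat_add.to_comp.comp (Computable.snd.comp Computable.snd)
      (hF.comp Computable.fst (Computable.fst.comp Computable.snd)))
  · intro a
    induction n a with
    | zero => rfl
    | succ k ih => rw [Finset.sum_range_succ, ← ih]

theorem exists_computable_search {α : Type*} [Primcodable α] {P : α → ℕ → Bool}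
    (hP : Computable₂ P) (h : ∀ a, ∃ n, P a n = true) :
    ∃ F : α → ℕ, Computable F ∧ ∀ a, P a (F a) = true := by
  refine ⟨fun a => Nat.find (h a), ?_, fun a => Nat.find_spec (h a)⟩
  have h₁ : Partrec fun a => Nat.rfind fun n => Part.some (P a n) := Partrec.rfind hP.partrec₂
  refine h₁.of_eq fun a => ?_
  refine Part.eq_some_iff.2 (Nat.mem_rfind.2 ⟨?_, fun {m} hm => ?_⟩)
  · simpa using Nat.find_spec (h a)
  · simpa using Nat.find_min (h a) hm

theorem Computable.bool_toNat {α : Type*} [Primcodable α] {P : α → Bool} (hP : Computable P) :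
    Computable fun a => (P a).toNat :=
  (Computable.cond hP (Computable.const 1) (Computable.const 0)).of_eq fun a => by
    cases P a <;> rfl

theorem Computable.decide_le {α : Type*} [Primcodable α] {F G : α → ℕ} (hF : Computable F)
    (hG : Computable G) : Computable fun a => decide (F a ≤ G a) :=
  Primrec.nat_le.decide.to_comp.comp hF hG

theorem Computable.decide_lt {α : Type*} [Primcodable α] {F G : α → ℕ} (hF : Computable F)
    (hG : Computable G) : Computable fun a => decide (F a < G a) :=
  Primrec.nat_lt.decide.to_comp.comp hF hG

theorem Computable.bool_and {α : Type*} [Primcodable α] {P Q : α → Bool} (hP : Computable P)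
    (hQ : Computable Q) : Computable fun a => P a && Q a :=
  Primrec.and.to_comp.comp hP hQ

theorem Computable.bool_not {α : Type*} [Primcodable α] {P : α → Bool} (hP : Computable P) :
    Computable fun a => !P a :=
  Primrec.not.to_comp.comp hP

/-- `levelBound f g s` is the left end of the `s`-th interval of colors. -/
def levelBound (f g : ℕ → ℕ → ℕ) : ℕ → ℕ
  | 0 => 0
  | s + 1 => levelBound f g s + 1 + ∑ x ∈ range s, ∑ z ∈ range s,
      ∑ y ∈ range (g x (levelBound f g s) + 1), f z y

/-- The edges meeting the `s`-th interval have index below `edgeBound f g s`. -/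
def edgeBound (f g : ℕ → ℕ → ℕ) (s : ℕ) : ℕ :=
  ∑ x ∈ range s, (g x (levelBound f g (s + 1)) + 1)

/-- The indicator of the first `m` elements of `P`. -/
def firstElems (P : ℕ → Bool) (m x : ℕ) : Bool :=
  P x && decide (∑ i ∈ range x, (P i).toNat < m)

/-- The first `m e` elements of `p s e` whose value with `y` is in the `s`-th interval. -/
def hitElems (f g : ℕ → ℕ → ℕ) (p : ℕ → ℕ → ℕ → Bool) (m : ℕ → ℕ) (s e y x : ℕ) : Bool :=
  firstElems (p s e) (m e) x &&
    (decide (levelBound f g s ≤ f x y) && decide (f x y < levelBound f g (s + 1)))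

/-- The coloring coded by the number `l`. -/
def codedColor (l n : ℕ) : Bool := decide (1 ≤ (Denumerable.ofNat (List ℕ) l).getD n 0)

/-- The edge `(e, y)` is large in the `s`-th interval but is not split by the coloring `l`. -/
def unsplit (f g : ℕ → ℕ → ℕ) (p : ℕ → ℕ → ℕ → Bool) (m r : ℕ → ℕ) (s l e y : ℕ) : Bool :=
  !firstElems (p s e) (m e) y &&
    (decide (r e ≤ ∑ x ∈ range s, (hitElems f g p m s e y x).toNat) &&
      !(decide (1 ≤ ∑ x ∈ range s,
          (hitElems f g p m s e y x && codedColor l (f x y)).toNat) &&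
        decide (1 ≤ ∑ x ∈ range s,
          (hitElems f g p m s e y x && !codedColor l (f x y)).toNat)))

/-- The coloring `l` splits all large edges of the `s`-th interval. -/
def splitsStage (f g : ℕ → ℕ → ℕ) (p : ℕ → ℕ → ℕ → Bool) (m r : ℕ → ℕ) (s l : ℕ) : Bool :=
  decide (∑ e ∈ range s, ∑ y ∈ range (edgeBound f g s),
    (unsplit f g p m r s l e y).toNat ≤ 0)

section Computability

variable {f g : ℕ → ℕ → ℕ} {p : ℕ → ℕ → ℕ → Bool} {m r : ℕ → ℕ}
  {α : Type*} [Primcodable α]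

theorem computable_levelBound (hf : Computable₂ f) (hg : Computable₂ g) :
    Computable (levelBound f g) := by
  refine (Computable.nat_rec (f := fun n : ℕ => n) (g := fun _ : ℕ => (0 : ℕ))
    (h := fun _ (q : ℕ × ℕ) => q.2 + 1 + ∑ x ∈ range q.1, ∑ z ∈ range q.1,
      ∑ y ∈ range (g x q.2 + 1), f z y) Computable.id (Computable.const 0) ?_).of_eq ?_
  · refine Primrec.nat_add.to_comp.comp
      (Computable.succ.comp (Computable.snd.comp Computable.snd)) ?_
    refine Computable.sum_range (Computable.fst.comp Computable.snd) ?_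
    refine Computable.sum_range (Computable.fst.comp (Computable.snd.comp Computable.fst)) ?_
    refine Computable.sum_range (Computable.succ.comp (hg.comp
      (Computable.snd.comp Computable.fst)
      (Computable.snd.comp (Computable.snd.comp (Computable.fst.comp Computable.fst))))) ?_
    exact hf.comp (Computable.snd.comp Computable.fst) Computable.snd
  · intro n
    induction n with
    | zero => rfl
    | succ k ih => simp only [levelBound, ← ih]

theorem computable_edgeBound (hf : Computable₂ f) (hg : Computable₂ g) :
    Computable (edgeBound f g) := by
  refine Computable.sum_range Computable.id ?_
  exact Computable.succ.comp (hg.comp Computable.snd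
    ((computable_levelBound hf hg).comp (Computable.succ.comp Computable.fst)))

theorem computable_firstElems (hp : Computable fun a : ℕ × ℕ × ℕ => p a.1 a.2.1 a.2.2)
    (hm : Computable m) {s e x : α → ℕ} (hs : Computable s) (he : Computable e)
    (hx : Computable x) : Computable fun a => firstElems (p (s a) (e a)) (m (e a)) (x a) := by
  refine Computable.bool_and (hp.comp (hs.pair (he.pair hx))) (Computable.decide_lt ?_
    (hm.comp he))
  refine Computable.sum_range hx (Computable.bool_toNat ?_)
  exact hp.comp ((hs.comp Computable.fst).pair ((he.comp Computable.fst).pair Computable.snd))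

theorem computable_hitElems (hf : Computable₂ f) (hg : Computable₂ g)
    (hp : Computable fun a : ℕ × ℕ × ℕ => p a.1 a.2.1 a.2.2) (hm : Computable m)
    {s e y x : α → ℕ} (hs : Computable s) (he : Computable e) (hy : Computable y)
    (hx : Computable x) : Computable fun a => hitElems f g p m (s a) (e a) (y a) (x a) := by
  have hN := computable_levelBound hf hg
  exact (computable_firstElems hp hm hs he hx).bool_and
    (((hN.comp hs).decide_le (hf.comp hx hy)).bool_and
      ((hf.comp hx hy).decide_lt (hN.comp (Computable.succ.comp hs))))

theorem computable_codedColor : Computable₂ codedColor :=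
  Computable.decide_le (Computable.const 1) ((Primrec.list_getD 0).to_comp.comp
    ((Primrec.ofNat (List ℕ)).to_comp.comp Computable.fst) Computable.snd)

theorem computable_unsplit (hf : Computable₂ f) (hg : Computable₂ g)
    (hp : Computable fun a : ℕ × ℕ × ℕ => p a.1 a.2.1 a.2.2) (hm : Computable m)
    (hr : Computable r) {s l e y : α → ℕ} (hs : Computable s) (hl : Computable l)
    (he : Computable e) (hy : Computable y) :
    Computable fun a => unsplit f g p m r (s a) (l a) (e a) (y a) := by
  have hH : Computable fun b : α × ℕ => hitElems f g p m (s b.1) (e b.1) (y b.1) b.2 :=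
    computable_hitElems hf hg hp hm (hs.comp Computable.fst) (he.comp Computable.fst)
      (hy.comp Computable.fst) Computable.snd
  have hC : Computable fun b : α × ℕ => codedColor (l b.1) (f b.2 (y b.1)) :=
    computable_codedColor.comp (hl.comp Computable.fst)
      (hf.comp Computable.snd (hy.comp Computable.fst))
  refine (computable_firstElems hp hm hs he hy).bool_not.bool_and
    (((hr.comp he).decide_le ?_).bool_and (((Computable.const 1).decide_le ?_).bool_and
      ((Computable.const 1).decide_le ?_)).bool_not)
  · exact Computable.sum_range hs hH.bool_toNat
  · exact Computable.sum_range hs (hH.bool_and hC).bool_toNat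
  · exact Computable.sum_range hs (hH.bool_and hC.bool_not).bool_toNat

theorem computable_splitsStage (hf : Computable₂ f) (hg : Computable₂ g)
    (hp : Computable fun a : ℕ × ℕ × ℕ => p a.1 a.2.1 a.2.2) (hm : Computable m)
    (hr : Computable r) : Computable₂ (splitsStage f g p m r) := by
  refine Computable.decide_le ?_ (Computable.const 0)
  refine Computable.sum_range Computable.fst ?_
  refine Computable.sum_range ((computable_edgeBound hf hg).comp
    (Computable.fst.comp Computable.fst)) ?_
  refine Computable.bool_toNat (computable_unsplit hf hg hp hm hr ?_ ?_ ?_ Computable.snd)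
  · exact Computable.fst.comp (Computable.fst.comp Computable.fst)
  · exact Computable.snd.comp (Computable.fst.comp Computable.fst)
  · exact Computable.snd.comp Computable.fst

end Computability

/-- The sets `T ⊆ S` that split every edge `F i`, `i ∈ A`, contained in `S`. -/
def splitters {ι V : Type*} [DecidableEq V] (A : Finset ι) (F : ι → Finset V) (S : Finset V) :
    Finset (Finset V) :=
  S.powerset.filter fun T => ∀ i ∈ A, F i ⊆ S → ¬ F i ⊆ T ∧ ¬ Disjoint (F i) T

section
variable {ι V : Type*} [DecidableEq V] {A : Finset ι} {F : ι → Finset V}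

theorem mem_splitters {S T : Finset V} : T ∈ splitters A F S ↔
    T ⊆ S ∧ ∀ i ∈ A, F i ⊆ S → ¬ F i ⊆ T ∧ ¬ Disjoint (F i) T := by
  simp [splitters]

theorem inter_mem_splitters {R S T : Finset V} (hRS : R ⊆ S) (hT : T ∈ splitters A F S) :
    T ∩ R ∈ splitters A F R := by
  rw [mem_splitters] at hT ⊢
  refine ⟨inter_subset_right, fun i hi hR => ?_⟩
  obtain ⟨h₁, h₂⟩ := hT.2 i hi (hR.trans hRS)
  refine ⟨fun h => h₁ (h.trans inter_subset_left), fun h => h₂ ?_⟩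
  rw [disjoint_left] at h ⊢
  exact fun a ha haT => h ha (mem_inter.2 ⟨haT, hR ha⟩)

/-- The one-vertex extensions of splitters of `S` that fail because of the edge `F i`. -/
def badExtensions (A : Finset ι) (F : ι → Finset V) (S : Finset V) (v : V) (i : ι) :
    Finset (Finset V) :=
  (insert v S).powerset.filter fun T =>
    T ∩ S ∈ splitters A F S ∧ (F i ⊆ T ∨ Disjoint (F i) T)

theorem card_badExtensions_le {S : Finset V} {v : V} {i : ι} (hv : v ∈ F i) :
    #(badExtensions A F S v i) ≤ 2 * #(splitters A F (S \ F i)) := by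
  have : badExtensions A F S v i ⊆
      (splitters A F (S \ F i)).image (fun T => T ∪ F i) ∪ splitters A F (S \ F i) := by
    intro T hT
    simp only [badExtensions, mem_filter, mem_powerset] at hT
    obtain ⟨hTS, hg, hc⟩ := hT
    have hm := inter_mem_splitters (sdiff_subset (s := S) (t := F i)) hg
    have e : T ∩ S ∩ (S \ F i) = T \ F i := by
      ext a
      have := @hTS a
      simp only [mem_inter, mem_sdiff, mem_insert] at *
      grind
    rw [e] at hm
    rw [mem_union, mem_image]
    rcases hc with hc | hc
    · exact Or.inl ⟨_, hm, sdiff_union_of_subset hc⟩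
    · right
      rwa [sdiff_eq_self_of_disjoint hc.symm] at hm
  calc _ ≤ _ := card_le_card this
    _ ≤ _ := card_union_le _ _
    _ ≤ _ := by have := card_image_le (s := splitters A F (S \ F i)) (f := fun T => T ∪ F i); omega

theorem two_mul_card_splitters_le {S : Finset V} {v : V} (hv : v ∉ S) :
    2 * #(splitters A F S) ≤ #(splitters A F (insert v S)) +
      ∑ i ∈ A with v ∈ F i ∧ F i ⊆ insert v S, #(badExtensions A F S v i) := by
  have hd : Disjoint (splitters A F S) ((splitters A F S).image (insert v)) := by
    rw [disjoint_left]
    intro T hT hT'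
    obtain ⟨U, -, rfl⟩ := mem_image.1 hT'
    exact hv ((mem_splitters.1 hT).1 (mem_insert_self v U))
  have hi : #((splitters A F S).image (insert v)) = #(splitters A F S) := by
    refine card_image_of_injOn fun T hT U hU h => ?_
    have hT := fun h => hv ((mem_splitters.1 hT).1 h)
    have hU := fun h => hv ((mem_splitters.1 hU).1 h)
    rw [← erase_insert hT, ← erase_insert hU]
    exact congrArg (fun s => erase s v) h
  rw [two_mul]
  nth_rewrite 2 [← hi]
  rw [← card_union_of_disjoint hd]
  refine (card_le_card (t := splitters A F (insert v S) ∪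
    (A.filter fun i => v ∈ F i ∧ F i ⊆ insert v S).biUnion (badExtensions A F S v)) ?_).trans
    ((card_union_le _ _).trans (Nat.add_le_add_left card_biUnion_le _))
  intro T hT
  have hT' : T ⊆ insert v S ∧ T ∩ S ∈ splitters A F S := by
    rcases mem_union.1 hT with h | h
    · have h' := (mem_splitters.1 h).1
      exact ⟨h'.trans (subset_insert _ _), by rwa [inter_eq_left.2 h']⟩
    · obtain ⟨U, hU, rfl⟩ := mem_image.1 h
      have h' := (mem_splitters.1 hU).1
      exact ⟨insert_subset_insert _ h', by rwa [insert_inter_of_notMem hv, inter_eq_left.2 h']⟩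
  by_cases hb : ∃ i ∈ A, (v ∈ F i ∧ F i ⊆ insert v S) ∧ (F i ⊆ T ∨ Disjoint (F i) T)
  · obtain ⟨i, hiA, hiv, hc⟩ := hb
    refine mem_union_right _ (mem_biUnion.2 ⟨i, mem_filter.2 ⟨hiA, hiv⟩, ?_⟩)
    exact mem_filter.2 ⟨mem_powerset.2 hT'.1, hT'.2, hc⟩
  · refine mem_union_left _ (mem_splitters.2 ⟨hT'.1, fun i hiA hiS => ?_⟩)
    by_cases hvi : v ∈ F i
    · have : ¬ (F i ⊆ T ∨ Disjoint (F i) T) := fun h => hb ⟨i, hiA, ⟨hvi, hiS⟩, h⟩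
      exact not_or.1 this
    · have hiS' : F i ⊆ S := (subset_insert_iff_of_notMem hvi).1 hiS
      obtain ⟨h₁, h₂⟩ := (mem_splitters.1 hT'.2).2 i hiA hiS'
      exact ⟨fun h => h₁ (subset_inter h hiS'), fun h => h₂ (h.mono_right inter_subset_left)⟩

/-- If every vertex has small weighted degree, the number of splitters grows by a factor of at
least `3/2` with each new vertex. -/
theorem card_splitters_insert
    (hF : ∀ v, ∑ i ∈ A with v ∈ F i, (2 / 3 : ℝ) ^ (#(F i) - 1) ≤ 1 / 4) (S : Finset V) :
    ∀ v ∉ S, (3 / 2 : ℝ) * #(splitters A F S) ≤ #(splitters A F (insert v S)) := by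
  induction S using Finset.strongInduction with
  | H S ih =>
    have key : ∀ R ⊆ S, (3 / 2 : ℝ) ^ #(S \ R) * #(splitters A F R) ≤ #(splitters A F S) := by
      suffices h : ∀ D R : Finset V, Disjoint D R → D ∪ R ⊆ S →
          (3 / 2 : ℝ) ^ #D * #(splitters A F R) ≤ #(splitters A F (D ∪ R)) by
        intro R hR
        simpa [sdiff_union_of_subset hR] using h (S \ R) R sdiff_disjoint
          (by rw [sdiff_union_of_subset hR])
      intro D R
      induction D using Finset.induction with
      | empty => simp
      | insert a D ha ihD =>
        intro hd hs
        rw [disjoint_insert_left] at hd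
        rw [insert_union] at hs ⊢
        have haDR : a ∉ D ∪ R := by simp [ha, hd.1]
        have h₁ := ihD hd.2 ((subset_insert _ _).trans hs)
        have h₂ := ih (D ∪ R) (ssubset_iff.2 ⟨a, haDR, hs⟩) a haDR
        rw [card_insert_of_notMem ha, pow_succ]
        linarith
    intro v hv
    have h₁ := two_mul_card_splitters_le (A := A) (F := F) hv
    have h₂ : ∀ i ∈ A.filter fun i => v ∈ F i ∧ F i ⊆ insert v S,
        (#(badExtensions A F S v i) : ℝ) ≤
          2 * #(splitters A F S) * (2 / 3 : ℝ) ^ (#(F i) - 1) := by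
      intro i hi
      obtain ⟨-, hvi, hiS⟩ := mem_filter.1 hi
      have h₃ : (#(badExtensions A F S v i) : ℝ) ≤ 2 * #(splitters A F (S \ F i)) := by
        exact_mod_cast card_badExtensions_le hvi
      have h₄ := key (S \ F i) sdiff_subset
      have h₅ : #(S \ (S \ F i)) = #(F i) - 1 := by
        rw [← card_erase_of_mem hvi]
        congr 1
        ext a
        have := @hiS a
        simp only [mem_sdiff, mem_erase, mem_insert] at *
        grind
      rw [h₅] at h₄
      have h₆ : (2 / 3 : ℝ) ^ (#(F i) - 1) * (3 / 2 : ℝ) ^ (#(F i) - 1) = 1 := by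
        rw [← mul_pow]; norm_num
      have h₇ := mul_le_mul_of_nonneg_left h₄
        (by positivity : (0 : ℝ) ≤ (2 / 3 : ℝ) ^ (#(F i) - 1))
      rw [← mul_assoc, h₆] at h₇
      linarith
    have h₃ : (2 : ℝ) * #(splitters A F S) ≤ #(splitters A F (insert v S)) +
        ∑ i ∈ A with v ∈ F i ∧ F i ⊆ insert v S, (#(badExtensions A F S v i) : ℝ) := by
      exact_mod_cast h₁
    have h₄ := sum_le_sum h₂
    rw [← mul_sum] at h₄
    have h₅ : ∑ i ∈ A with v ∈ F i ∧ F i ⊆ insert v S, (2 / 3 : ℝ) ^ (#(F i) - 1) ≤ 1 / 4 :=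
      (sum_le_sum_of_subset_of_nonneg (fun i hi => by
        simp only [mem_filter] at hi ⊢
        exact ⟨hi.1, hi.2.1⟩) (fun _ _ _ => by positivity)).trans (hF v)
    have h₆ := mul_le_mul_of_nonneg_left h₅
      (by positivity : (0 : ℝ) ≤ 2 * #(splitters A F S))
    linarith

/-- A finite hypergraph with nonempty edges and small weighted degrees has a proper
two-coloring. -/
theorem exists_splitter (hne : ∀ i ∈ A, (F i).Nonempty)
    (hF : ∀ v, ∑ i ∈ A with v ∈ F i, (2 / 3 : ℝ) ^ (#(F i) - 1) ≤ 1 / 4) :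
    ∃ T : Finset V, ∀ i ∈ A, (∃ a ∈ F i, a ∈ T) ∧ ∃ a ∈ F i, a ∉ T := by
  have hpos : ∀ S, (0 : ℝ) < #(splitters A F S) := by
    intro S
    induction S using Finset.induction with
    | empty =>
      have : ∅ ∈ splitters A F ∅ := mem_splitters.2 ⟨Subset.rfl, fun i hi h =>
        absurd (subset_empty.1 h) (hne i hi).ne_empty⟩
      exact_mod_cast card_pos.2 ⟨_, this⟩
    | insert a S ha ih =>
      have := card_splitters_insert hF S a ha
      linarith
  obtain ⟨T, hT⟩ := card_pos.1 (Nat.cast_pos.1 (hpos (A.biUnion F)))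
  refine ⟨T, fun i hi => ?_⟩
  obtain ⟨h₁, h₂⟩ := (mem_splitters.1 hT).2 i hi (subset_biUnion_of_mem F hi)
  exact ⟨not_disjoint_iff.1 h₂, not_subset.1 h₁⟩
end

section Splitting

variable {f g : ℕ → ℕ → ℕ} {p : ℕ → ℕ → ℕ → Bool} {b : ℕ} {k : ℕ → ℕ}

theorem exists_splitting_set (hsym : ∀ x y, f x y = f y x)
    (hfib : ∀ x v, ∀ S : Finset ℕ, (∀ z ∈ S, z ≠ x ∧ f x z = v) → #S ≤ b)
    (hb : 1 ≤ b) (hk : ∀ e, 1 ≤ k e)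
    (hsum : ∀ s, ∑ e ∈ range s, (2 * b * k e * b : ℕ) * (2 / 3 : ℝ) ^ (k e - 1) ≤ 1 / 4)
    (s Y : ℕ) (E : ℕ → Finset ℕ) (hE : ∀ e, #(E e) ≤ 2 * b * k e) (I : Finset ℕ) :
    ∃ T : Finset ℕ, ∀ e < s, ∀ y < Y, y ∉ E e → b * k e ≤ #{x ∈ E e | f x y ∈ I} →
      (∃ x ∈ E e, f x y ∈ I ∧ f x y ∈ T) ∧ ∃ x ∈ E e, f x y ∈ I ∧ f x y ∉ T := by
  set A : Finset (ℕ × ℕ) := (range s ×ˢ range Y).filter fun i =>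
    i.2 ∉ E i.1 ∧ b * k i.1 ≤ #{x ∈ E i.1 | f x i.2 ∈ I} with hA
  set F : ℕ × ℕ → Finset ℕ := fun i => {x ∈ E i.1 | f x i.2 ∈ I}.image fun x => f x i.2 with hF
  have hcard : ∀ i ∈ A, k i.1 ≤ #(F i) := by
    intro i hi
    obtain ⟨-, hiE, hir⟩ := mem_filter.1 hi
    have h := card_le_mul_card_image (f := fun x => f x i.2) {x ∈ E i.1 | f x i.2 ∈ I} b
      fun v _ => hfib i.2 v _ fun z hz => by
        simp only [mem_filter] at hz
        exact ⟨fun h => hiE (h ▸ hz.1.1), by rw [hsym]; exact hz.2⟩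
    exact Nat.le_of_mul_le_mul_left (hir.trans h) hb
  obtain ⟨T, hT⟩ := exists_splitter (A := A) (F := F)
    (fun i hi => card_pos.1 ((hk _).trans (hcard i hi))) (fun v => by
      have hdeg : ∀ e, #{i ∈ A.filter (fun i => v ∈ F i) | i.1 = e} ≤ 2 * b * k e * b := by
        intro e
        have hinj : Set.InjOn Prod.snd
            (({i ∈ A.filter (fun i => v ∈ F i) | i.1 = e} : Finset (ℕ × ℕ)) : Set (ℕ × ℕ)) := by
          intro i hi j hj h
          have hi := (mem_filter.1 (mem_coe.1 hi)).2
          have hj := (mem_filter.1 (mem_coe.1 hj)).2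
          exact Prod.ext (hi.trans hj.symm) h
        rw [← card_image_of_injOn hinj]
        refine (card_le_card (t := (E e).biUnion fun x =>
          (range Y).filter fun y => y ≠ x ∧ f x y = v) ?_).trans
          ((card_biUnion_le_card_mul _ _ b fun x _ => hfib x v _ fun z hz =>
            (mem_filter.1 hz).2).trans (Nat.mul_le_mul_right _ (hE e)))
        intro y hy
        simp only [hA, hF, mem_image, mem_filter, mem_product, mem_range, Prod.exists] at hy
        obtain ⟨e', y', ⟨⟨⟨⟨-, hyY⟩, hyE, -⟩, x, ⟨hx, -⟩, hv⟩, rfl⟩, rfl⟩ := hy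
        exact mem_biUnion.2 ⟨x, hx, mem_filter.2
          ⟨mem_range.2 hyY, fun h => hyE (h ▸ hx), hv⟩⟩
      calc ∑ i ∈ A with v ∈ F i, (2 / 3 : ℝ) ^ (#(F i) - 1)
          ≤ ∑ i ∈ A with v ∈ F i, (2 / 3 : ℝ) ^ (k i.1 - 1) :=
            sum_le_sum fun i hi => pow_le_pow_of_le_one (by norm_num) (by norm_num)
              (Nat.sub_le_sub_right (hcard i (mem_filter.1 hi).1) 1)
        _ = ∑ e ∈ range s, ∑ i ∈ A.filter (fun i => v ∈ F i) with i.1 = e,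
              (2 / 3 : ℝ) ^ (k i.1 - 1) :=
            (sum_fiberwise_of_maps_to (fun i hi =>
              (mem_product.1 (mem_filter.1 (mem_filter.1 hi).1).1).1) _).symm
        _ ≤ ∑ e ∈ range s, (2 * b * k e * b : ℕ) * (2 / 3 : ℝ) ^ (k e - 1) := by
            refine sum_le_sum fun e _ => ?_
            rw [sum_congr rfl (g := fun _ => (2 / 3 : ℝ) ^ (k e - 1))
              fun i hi => by rw [(mem_filter.1 hi).2], sum_const, nsmul_eq_mul]
            exact mul_le_mul_of_nonneg_right (Nat.cast_le.2 (hdeg e)) (by positivity)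
        _ ≤ 1 / 4 := hsum s)
  refine ⟨T, fun e he y hy hyE hr => ?_⟩
  obtain ⟨⟨u, hu, huT⟩, w, hw, hwT⟩ := hT (e, y)
    (mem_filter.2 ⟨mem_product.2 ⟨mem_range.2 he, mem_range.2 hy⟩, hyE, hr⟩)
  simp only [hF, mem_image, mem_filter] at hu hw
  obtain ⟨x, ⟨hx, hxI⟩, rfl⟩ := hu
  obtain ⟨z, ⟨hz, hzI⟩, rfl⟩ := hw
  exact ⟨⟨x, hx, hxI, huT⟩, z, hz, hzI, hwT⟩

theorem sum_toNat_eq_card (P : ℕ → Bool) (S : Finset ℕ) :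
    ∑ x ∈ S, (P x).toNat = #{x ∈ S | P x = true} := by
  rw [card_filter]
  exact sum_congr rfl fun x _ => by cases P x <;> rfl

theorem card_firstElems (P : ℕ → Bool) (m n : ℕ) :
    #{x ∈ range n | firstElems P m x = true} = min m (∑ x ∈ range n, (P x).toNat) := by
  rw [← sum_toNat_eq_card]
  induction n with
  | zero => simp
  | succ n ih =>
    rw [sum_range_succ, sum_range_succ, ih, firstElems]
    cases P n <;> by_cases h : ∑ x ∈ range n, (P x).toNat < m <;> simp [h] <;> omega

/-- The color coded by some number is an arbitrary set below a given bound. -/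
theorem exists_codedColor (T : Finset ℕ) (M : ℕ) :
    ∃ l, ∀ n < M, codedColor l n = decide (n ∈ T) := by
  refine ⟨Encodable.encode ((List.range M).map fun n => if n ∈ T then 1 else 0), fun n hn => ?_⟩
  rw [codedColor, Denumerable.ofNat_encode]
  by_cases h : n ∈ T <;> simp [List.getD, hn, h]

theorem exists_splitsStage (hsym : ∀ x y, f x y = f y x)
    (hfib : ∀ x v, ∀ S : Finset ℕ, (∀ z ∈ S, z ≠ x ∧ f x z = v) → #S ≤ b)
    (hb : 1 ≤ b) (hk : ∀ e, 1 ≤ k e)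
    (hsum : ∀ s, ∑ e ∈ range s, (2 * b * k e * b : ℕ) * (2 / 3 : ℝ) ^ (k e - 1) ≤ 1 / 4)
    (s : ℕ) :
    ∃ l, splitsStage f g p (fun e => 2 * b * k e) (fun e => b * k e) s l = true := by
  obtain ⟨T, hT⟩ := exists_splitting_set hsym hfib hb hk hsum s (edgeBound f g s)
    (fun e => {x ∈ range s | firstElems (p s e) (2 * b * k e) x = true})
    (fun e => (card_firstElems _ _ _).trans_le (min_le_left _ _))
    (Ico (levelBound f g s) (levelBound f g (s + 1)))
  obtain ⟨l, hl⟩ := exists_codedColor T (levelBound f g (s + 1))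
  refine ⟨l, ?_⟩
  rw [splitsStage, decide_eq_true_iff, Nat.le_zero, sum_eq_zero_iff]
  intro e he
  rw [sum_eq_zero_iff]
  intro y hy
  rw [Bool.toNat_eq_zero, Bool.eq_false_iff]
  intro hu
  simp only [unsplit, Bool.and_eq_true, Bool.not_eq_true', decide_eq_true_iff,
    sum_toNat_eq_card] at hu
  obtain ⟨hyE, hr, hc⟩ := hu
  obtain ⟨⟨x, hx, hxI, hxT⟩, z, hz, hzI, hzT⟩ := hT e (mem_range.1 he) y (mem_range.1 hy)
    (by simp [hyE]) (hr.trans (card_le_card fun x hx => by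
      simpa [hitElems, and_assoc] using hx))
  rw [mem_filter] at hx hz
  rw [mem_Ico] at hxI hzI
  rw [Bool.and_eq_false_iff, decide_eq_false_iff_not, decide_eq_false_iff_not,
    Nat.one_le_iff_ne_zero, Nat.one_le_iff_ne_zero, card_ne_zero, card_ne_zero] at hc
  rcases hc with hc | hc
  · exact hc ⟨x, by simp [hitElems, hx.2, mem_range.1 hx.1, hxI.1, hxI.2, hl _ hxI.2, hxT]⟩
  · exact hc ⟨z, by simp [hitElems, hz.2, mem_range.1 hz.1, hzI.1, hzI.2, hl _ hzI.2, hzT]⟩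

theorem exists_hitElems_of_splitsStage {m r : ℕ → ℕ} {s l e y : ℕ}
    (h : splitsStage f g p m r s l = true) (he : e < s) (hy : y < edgeBound f g s)
    (hyE : firstElems (p s e) (m e) y = false)
    (hr : r e ≤ #{x ∈ range s | hitElems f g p m s e y x = true}) :
    (∃ x, hitElems f g p m s e y x = true ∧ codedColor l (f x y) = true) ∧
      ∃ x, hitElems f g p m s e y x = true ∧ codedColor l (f x y) = false := by
  rw [splitsStage, decide_eq_true_iff, Nat.le_zero, sum_eq_zero_iff] at h
  have h := h e (mem_range.2 he)
  rw [sum_eq_zero_iff] at h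
  have h := h y (mem_range.2 hy)
  simp only [unsplit, hyE, sum_toNat_eq_card, hr, decide_true, Bool.true_and, Bool.not_false,
    Bool.toNat_eq_zero, Bool.not_eq_false', Bool.and_eq_true, decide_eq_true_iff,
    Nat.one_le_iff_ne_zero, card_ne_zero] at h
  obtain ⟨⟨x, hx⟩, z, hz⟩ := h
  simp only [mem_filter, Bool.not_eq_true'] at hx hz
  exact ⟨⟨x, hx.2⟩, z, hz.2⟩

theorem levelBound_lt_succ (f g : ℕ → ℕ → ℕ) (s : ℕ) :
    levelBound f g s < levelBound f g (s + 1) := by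
  rw [levelBound]
  omega

theorem strictMono_levelBound (f g : ℕ → ℕ → ℕ) : StrictMono (levelBound f g) :=
  strictMono_nat_of_lt_succ (levelBound_lt_succ f g)

theorem exists_level (f g : ℕ → ℕ → ℕ) (n : ℕ) :
    ∃ s, levelBound f g s ≤ n ∧ n < levelBound f g (s + 1) := by
  induction n with
  | zero => exact ⟨0, le_rfl, by simp [levelBound]⟩
  | succ n ih =>
    obtain ⟨s, h₁, h₂⟩ := ih
    by_cases h : n + 1 < levelBound f g (s + 1)
    · exact ⟨s, by omega, h⟩
    · exact ⟨s + 1, by omega, by have := levelBound_lt_succ f g (s + 1); omega⟩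

theorem level_unique {n s t : ℕ} (hs : levelBound f g s ≤ n ∧ n < levelBound f g (s + 1))
    (ht : levelBound f g t ≤ n ∧ n < levelBound f g (t + 1)) : s = t := by
  have h₁ := (strictMono_levelBound f g).lt_iff_lt.1 (hs.1.trans_lt ht.2)
  have h₂ := (strictMono_levelBound f g).lt_iff_lt.1 (ht.1.trans_lt hs.2)
  omega

/-- Values with the same `y` lie in at most two consecutive intervals. -/
theorem lt_levelBound_succ (hg : ∀ x n y, y > g x n → f x y > n) {s x z y : ℕ} (hx : x < s)
    (hz : z < s) (h : f x y < levelBound f g s) : f z y < levelBound f g (s + 1) := by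
  have hy : y ≤ g x (levelBound f g s) := by
    by_contra hlt
    exact absurd (hg _ _ _ (not_le.1 hlt)) (not_lt.2 h.le)
  have h₁ := single_le_sum (f := fun y => f z y) (fun _ _ => Nat.zero_le _)
    (mem_range.2 (Nat.lt_succ_of_le hy))
  have h₂ := single_le_sum
    (f := fun z => ∑ y ∈ range (g x (levelBound f g s) + 1), f z y)
    (fun _ _ => Nat.zero_le _) (mem_range.2 hz)
  have h₃ := single_le_sum
    (f := fun x => ∑ z ∈ range s, ∑ y ∈ range (g x (levelBound f g s) + 1), f z y)
    (fun _ _ => Nat.zero_le _) (mem_range.2 hx)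
  simp only [Nat.succ_eq_add_one] at h₁ h₂ h₃
  rw [levelBound]
  omega

theorem lt_edgeBound (hg : ∀ x n y, y > g x n → f x y > n) {s x y : ℕ} (hx : x < s)
    (h : f x y < levelBound f g (s + 1)) : y < edgeBound f g s := by
  have hy : y ≤ g x (levelBound f g (s + 1)) := by
    by_contra hlt
    exact absurd (hg _ _ _ (not_le.1 hlt)) (not_lt.2 h.le)
  have h₁ := single_le_sum (f := fun x => g x (levelBound f g (s + 1)) + 1)
    (fun _ _ => Nat.zero_le _) (mem_range.2 hx)
  rw [edgeBound]
  omega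

/-- If `p s e` converges to `q`, then its first `m` elements are eventually those of `q`. -/
theorem eventually_firstElems {P : ℕ → ℕ → Bool} {q : ℕ → Bool}
    (hq : ∀ x, ∀ᶠ s in Filter.atTop, P s x = q x) {m n : ℕ}
    (hn : m ≤ ∑ i ∈ range n, (q i).toNat) :
    ∀ᶠ s in Filter.atTop, ∀ x, firstElems (P s) m x = (decide (x < n) && firstElems q m x) := by
  have h : ∀ᶠ s in Filter.atTop, ∀ x ∈ range n, P s x = q x :=
    (Filter.eventually_all_finset _).2 fun x _ => hq x
  filter_upwards [h] with s hs x
  by_cases hx : x < n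
  · have : ∑ i ∈ range x, (P s i).toNat = ∑ i ∈ range x, (q i).toNat :=
      sum_congr rfl fun i hi => by
        rw [hs i (mem_range.2 ((mem_range.1 hi).trans hx))]
    simp [firstElems, hx, hs x (mem_range.2 hx), this]
  · have h₁ : ∑ i ∈ range n, (P s i).toNat = ∑ i ∈ range n, (q i).toNat :=
      sum_congr rfl fun i hi => by rw [hs i hi]
    have h₂ : ∑ i ∈ range n, (P s i).toNat ≤ ∑ i ∈ range x, (P s i).toNat :=
      sum_le_sum_of_subset (range_subset_range.2 (not_lt.1 hx))
    simp only [firstElems, hx, decide_false, Bool.false_and, Bool.and_eq_false_iff,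
      decide_eq_false_iff_not]
    right
    omega

theorem exists_computable_splitting_coloring (hf : Computable₂ f)
    (hsym : ∀ x y, f x y = f y x) (hgc : Computable₂ g)
    (hg : ∀ x n y, y > g x n → f x y > n)
    (hfib : ∀ x v, ∀ S : Finset ℕ, (∀ z ∈ S, z ≠ x ∧ f x z = v) → #S ≤ b)
    (hb : 1 ≤ b) (hkc : Computable k) (hk : ∀ e, 1 ≤ k e)
    (hsum : ∀ s, ∑ e ∈ range s, (2 * b * k e * b : ℕ) * (2 / 3 : ℝ) ^ (k e - 1) ≤ 1 / 4)
    (hp : Computable fun a : ℕ × ℕ × ℕ => p a.1 a.2.1 a.2.2) :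
    ∃ c : ℕ → Bool, Computable c ∧ ∀ e (q : ℕ → Bool),
      (∀ x, ∀ᶠ s in Filter.atTop, p s e x = q x) → ∀ n,
      2 * b * k e ≤ ∑ i ∈ range n, (q i).toNat → ∃ y₀, ∀ y ≥ y₀,
        (∃ x, q x = true ∧ x ≠ y ∧ c (f x y) = true) ∧
          ∃ x, q x = true ∧ x ≠ y ∧ c (f x y) = false := by
  have hm : Computable fun e => 2 * b * k e :=
    Primrec.nat_mul.to_comp.comp (Computable.const (2 * b)) hkc
  have hr : Computable fun e => b * k e :=
    Primrec.nat_mul.to_comp.comp (Computable.const b) hkc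
  obtain ⟨τ, hτc, hτ⟩ := exists_computable_search (computable_splitsStage hf hgc hp hm hr)
    (exists_splitsStage (g := g) (p := p) hsym hfib hb hk hsum)
  have hN := computable_levelBound hf hgc
  have hlev : Computable₂ fun n s : ℕ =>
      decide (levelBound f g s ≤ n) && decide (n < levelBound f g (s + 1)) :=
    ((hN.comp Computable.snd).decide_le Computable.fst).bool_and
      (Computable.fst.decide_lt (hN.comp (Computable.succ.comp Computable.snd)))
  obtain ⟨σ, hσc, hσ⟩ := exists_computable_search hlev fun n => by
    simpa using exists_level f g n
  simp only [Bool.and_eq_true, decide_eq_true_iff] at hσ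
  refine ⟨fun n => codedColor (τ (σ n)) n,
    computable_codedColor.comp (hτc.comp hσc) Computable.id, fun e q hq n hn => ?_⟩
  obtain ⟨s₀, hs₀⟩ := Filter.eventually_atTop.1 (eventually_firstElems hq hn)
  set E : Finset ℕ := {x ∈ range n | firstElems q (2 * b * k e) x = true} with hEdef
  have hEcard : #E = 2 * b * k e := by rw [hEdef, card_firstElems, min_eq_left hn]
  have hmemE : ∀ s ≥ s₀, ∀ x, firstElems (p s e) (2 * b * k e) x = true ↔ x ∈ E := by
    intro s hs x
    rw [hs₀ s hs x, hEdef, mem_filter, mem_range, Bool.and_eq_true, decide_eq_true_iff]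
  have hEn : ∀ x ∈ E, x < n := fun x hx => mem_range.1 (mem_filter.1 hx).1
  have hEq : ∀ x ∈ E, q x = true := fun x hx => by
    have h := (mem_filter.1 hx).2
    rw [firstElems, Bool.and_eq_true] at h
    exact h.1
  clear_value E
  set s₁ := s₀ + n + e + 1 with hs₁
  refine ⟨n + ∑ x ∈ range n, (g x (levelBound f g s₁) + 1), fun y hy => ?_⟩
  have hyE : y ∉ E := fun h => by have := hEn y h; omega
  have hlarge : ∀ x ∈ E, levelBound f g s₁ ≤ f x y := fun x hx => by
    have h := single_le_sum (f := fun x => g x (levelBound f g s₁) + 1)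
      (fun _ _ => Nat.zero_le _) (mem_range.2 (hEn x hx))
    exact (hg x _ y (by omega)).le
  have hEne : E.Nonempty := by
    rw [← card_pos, hEcard]
    have := Nat.mul_pos hb (hk e)
    rw [mul_assoc]
    omega
  obtain ⟨x₀, hx₀, hmin⟩ := exists_min_image E (fun x => f x y) hEne
  obtain ⟨s, hs⟩ := exists_level f g (f x₀ y)
  have hss : s₁ ≤ s := by
    have := (strictMono_levelBound f g).lt_iff_lt.1 ((hlarge x₀ hx₀).trans_lt hs.2)
    omega
  have hup : ∀ x ∈ E, f x y < levelBound f g (s + 2) := fun x hx =>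
    lt_levelBound_succ hg (by have := hEn x₀ hx₀; omega) (by have := hEn x hx; omega) hs.2
  have hhit : ∀ t ≥ s₁, ∀ x, hitElems f g p (fun e => 2 * b * k e) t e y x = true ↔
      x ∈ E ∧ levelBound f g t ≤ f x y ∧ f x y < levelBound f g (t + 1) := by
    intro t ht x
    rw [← hmemE t (by omega) x]
    simp [hitElems]
  have hdone : ∀ t ≥ s₁, b * k e ≤ #{x ∈ E | levelBound f g t ≤ f x y ∧
      f x y < levelBound f g (t + 1)} →
      (∃ x, q x = true ∧ x ≠ y ∧ codedColor (τ (σ (f x y))) (f x y) = true) ∧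
        ∃ x, q x = true ∧ x ≠ y ∧ codedColor (τ (σ (f x y))) (f x y) = false := by
    intro t ht hc
    have hpos : 0 < #{x ∈ E | levelBound f g t ≤ f x y ∧ f x y < levelBound f g (t + 1)} :=
      (Nat.mul_pos hb (hk e)).trans_le hc
    obtain ⟨w, hw⟩ := card_pos.1 hpos
    rw [mem_filter] at hw
    have hyt : y < edgeBound f g t :=
      lt_edgeBound hg (by have := hEn w hw.1; omega) hw.2.2
    have hyt' : firstElems (p t e) (2 * b * k e) y = false := by
      rw [Bool.eq_false_iff, ne_eq, hmemE t (by omega) y]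
      exact hyE
    obtain ⟨⟨x, hx, hxc⟩, z, hz, hzc⟩ := exists_hitElems_of_splitsStage (hτ t)
      (by omega) hyt hyt' (hc.trans (card_le_card fun x hx => by
        rw [mem_filter] at hx ⊢
        exact ⟨mem_range.2 (by have := hEn x hx.1; omega), (hhit t ht x).2 hx⟩))
    rw [hhit t ht] at hx hz
    refine ⟨⟨x, hEq x hx.1, fun h => hyE (h ▸ hx.1), ?_⟩,
      z, hEq z hz.1, fun h => hyE (h ▸ hz.1), ?_⟩
    · rwa [level_unique (hσ (f x y)) hx.2]
    · rwa [level_unique (hσ (f z y)) hz.2]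
  have hcover : E ⊆
      {x ∈ E | levelBound f g s ≤ f x y ∧ f x y < levelBound f g (s + 1)} ∪
      {x ∈ E | levelBound f g (s + 1) ≤ f x y ∧ f x y < levelBound f g (s + 1 + 1)} := by
    intro x hx
    have h₁ := hmin x hx
    have h₂ := hup x hx
    rw [mem_union, mem_filter, mem_filter]
    rcases lt_or_ge (f x y) (levelBound f g (s + 1)) with h | h
    · exact Or.inl ⟨hx, hs.1.trans h₁, h⟩
    · exact Or.inr ⟨hx, h, h₂⟩
  have hle := (card_le_card hcover).trans (card_union_le _ _)
  rw [hEcard, mul_assoc] at hle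
  by_cases h : b * k e ≤ #{x ∈ E | levelBound f g s ≤ f x y ∧ f x y < levelBound f g (s + 1)}
  · exact hdone s hss h
  · exact hdone (s + 1) (by omega) (by omega)

end Splitting

/-- Linearly growing edge sizes make the weighted degrees small. -/
theorem exists_small_weights (C : ℕ) : ∃ K : ℕ, 1 ≤ K ∧ ∀ s,
    ∑ e ∈ range s, ((C * (e + K) : ℕ) : ℝ) * (2 / 3 : ℝ) ^ (e + K - 1) ≤ 1 / 4 := by
  set w : ℕ → ℝ := fun n => ((C * n : ℕ) : ℝ) * (2 / 3 : ℝ) ^ (n - 1) with hw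
  have hsm : Summable w := by
    have h := (summable_pow_mul_geometric_of_norm_lt_one (R := ℝ) 1
      (r := 2 / 3) (by norm_num)).mul_left (C * (3 / 2) : ℝ)
    refine h.congr fun n => ?_
    rcases n with _ | n
    · simp [hw]
    · simp only [hw, Nat.add_sub_cancel]
      push_cast
      ring
  have hnn : ∀ n, 0 ≤ w n := fun n => by simp only [hw]; positivity
  obtain ⟨K, hK, hK₁⟩ := (((tendsto_sum_nat_add w).eventually_lt_const
    (by norm_num : (0 : ℝ) < 1 / 4)).and (Filter.eventually_ge_atTop 1)).exists
  refine ⟨K, hK₁, fun s => ?_⟩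
  exact (((summable_nat_add_iff K).2 hsm).sum_le_tsum (range s) fun n _ => hnn _).trans hK.le

theorem computable_evaln_isSome :
    Computable fun a : ℕ × ℕ × ℕ => (Nat.Partrec.Code.evaln a.1
      (Denumerable.ofNat Nat.Partrec.Code a.2.1) a.2.2).isSome :=
  (Primrec.option_isSome.comp (Nat.Partrec.Code.primrec_evaln.comp
    ((Primrec.fst.pair ((Primrec.ofNat Nat.Partrec.Code).comp
      (Primrec.fst.comp Primrec.snd))).pair (Primrec.snd.comp Primrec.snd)))).to_comp

open Classical in
theorem eventually_evaln_isSome (e : Nat.Partrec.Code) (x : ℕ) :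
    ∀ᶠ s in Filter.atTop, (Nat.Partrec.Code.evaln s e x).isSome = decide (e.eval x).Dom := by
  by_cases h : (e.eval x).Dom
  · obtain ⟨v, hv⟩ := Part.dom_iff_mem.1 h
    obtain ⟨t, ht⟩ := Nat.Partrec.Code.evaln_complete.1 hv
    filter_upwards [Filter.eventually_ge_atTop t] with s hs
    rw [decide_eq_true h, Option.isSome_iff_exists]
    exact ⟨v, Nat.Partrec.Code.evaln_mono hs ht⟩
  · refine Filter.Eventually.of_forall fun s => ?_
    rw [decide_eq_false h, Bool.eq_false_iff]
    intro hs
    obtain ⟨v, hv⟩ := Option.isSome_iff_exists.1 hs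
    exact h (Part.dom_iff_mem.2 ⟨v, Nat.Partrec.Code.evaln_sound hv⟩)

theorem Set.exists_subset_card_eq_of_not_ncard_lt {W : Set ℕ} {m : ℕ}
    (h : ¬ (W.Finite ∧ W.ncard < m)) : ∃ U : Finset ℕ, (U : Set ℕ) ⊆ W ∧ #U = m := by
  by_cases hW : W.Finite
  · have hm : m ≤ #hW.toFinset := by
      rw [← Set.ncard_eq_toFinset_card W hW]
      exact not_lt.1 fun hlt => h ⟨hW, hlt⟩
    obtain ⟨U, hU, hc⟩ := Finset.exists_subset_card_eq hm
    exact ⟨U, fun x hx => hW.mem_toFinset.1 (hU hx), hc⟩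
  · exact Set.Infinite.exists_subset_card_eq hW m

/-- For any symmetric addition-like `f`, there is a computable instance `c` of `RT^f_2`
together with a computable bound `h` witnessing that every solution of `c` is
effectively immune: if `H` is an infinite set with `c (f x y)` constant over distinct
`x, y ∈ H`, then any c.e. set `W_e ⊆ H` is finite of cardinality less than `h e`. -/
theorem stmt_3 (f : ℕ → ℕ → ℕ) (hsym : ∀ x y, f x y = f y x) (hf : AdditionLike f) :
    ∃ c : ℕ → Bool, ∃ h : ℕ → ℕ, Computable c ∧ Computable h ∧
      ∀ H : Set ℕ, H.Infinite →
        (∃ i : Bool, ∀ x ∈ H, ∀ y ∈ H, x ≠ y → c (f x y) = i) →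
        ∀ e : Nat.Partrec.Code,
          {n : ℕ | (e.eval n).Dom} ⊆ H →
            {n : ℕ | (e.eval n).Dom}.Finite ∧
              {n : ℕ | (e.eval n).Dom}.ncard < h (Encodable.encode e) := by
  classical
  obtain ⟨hfc, ⟨g, hgc, hg⟩, b, hb⟩ := hf
  have hfib : ∀ x v, ∀ S : Finset ℕ, (∀ z ∈ S, z ≠ x ∧ f x z = v) → #S ≤ b + 1 := by
    intro x v S hS
    rcases S.eq_empty_or_nonempty with rfl | ⟨y, hy⟩
    · simp
    · exact (hb x y (hS y hy).1.symm S fun z hz =>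
        ⟨(hS z hz).1, (hS z hz).2.trans (hS y hy).2.symm⟩).trans (Nat.le_succ b)
  obtain ⟨K, hK, hsum⟩ := exists_small_weights (2 * (b + 1) * (b + 1))
  have hkc : Computable fun e => e + K :=
    Primrec.nat_add.to_comp.comp Computable.id (Computable.const K)
  obtain ⟨c, hc, hsplit⟩ := exists_computable_splitting_coloring (b := b + 1)
    (k := fun e => e + K) (p := fun s e x => (Nat.Partrec.Code.evaln s
      (Denumerable.ofNat Nat.Partrec.Code e) x).isSome) hfc hsym hgc hg hfib (Nat.succ_pos b) hkc
    (fun e => hK.trans (Nat.le_add_left K e))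
    (fun s => by simpa only [mul_right_comm] using hsum s) computable_evaln_isSome
  refine ⟨c, fun e => 2 * (b + 1) * (e + K), hc,
    Primrec.nat_mul.to_comp.comp (Computable.const _) hkc, ?_⟩
  rintro H hH ⟨i, hi⟩ e hW
  by_contra hcon
  obtain ⟨U, hUW, hU⟩ := Set.exists_subset_card_eq_of_not_ncard_lt hcon
  obtain ⟨y₀, hy₀⟩ := hsplit (Encodable.encode e) (fun x => decide (e.eval x).Dom)
    (fun x => by simpa only [Denumerable.ofNat_encode] using eventually_evaln_isSome e x)
    (U.sup id + 1) (by
      rw [sum_toNat_eq_card]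
      refine hU.ge.trans (card_le_card fun x hx => mem_filter.2 ⟨mem_range.2 ?_, decide_eq_true (hUW hx)⟩)
      exact Nat.lt_succ_of_le (le_sup (f := id) hx))
  obtain ⟨y, hyH, hy⟩ := hH.exists_gt y₀
  obtain ⟨⟨x, hx, hxy, hxc⟩, z, hz, hzy, hzc⟩ := hy₀ y hy.le
  have h₁ := hi x (hW (of_decide_eq_true hx)) y hyH hxy
  have h₂ := hi z (hW (of_decide_eq_true hz)) y hyH hzy
  rw [hxc] at h₁
  rw [hzc, ← h₁] at h₂
  exact Bool.false_ne_true h₂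
end
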